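/- Let X be an exponential random variable with rate parameter 1 (law with density e^{−x} on [0,∞)) and let Y = 1 + X. Then for every n ≥ 1, the n-th moment of Y equals the number of positroids on [n]; that is, E[Y^n] = ∫_0^∞ (1+x)^n e^{−x} dx = p(n). -/

import Mathlib

open Finset

/-- A full-row-rank real `d × n` matrix is *totally nonnegative* if all of its
maximal (`d × d`) minors are nonnegative.  Columns are indexed by a finite
linearly ordered set `E`; a maximal minor is indexed by a strictly increasing
choice of `d` columns. -/
def Matrix.TotallyNonneg {d : ℕ} {E : Type*} [Fintype E] [LinearOrder E]
    (A : Matrix (Fin d) E ℝ) : Prop :=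
  A.rank = d ∧ ∀ f : Fin d → E, StrictMono f → 0 ≤ (A.submatrix id f).det

/-- `ℬ` is the collection of bases of the column matroid `M(A)`: the `d`-element
sets of column indices whose columns are linearly independent. -/
def Matrix.RepresentsBases {d : ℕ} {E : Type*} [Fintype E]
    (A : Matrix (Fin d) E ℝ) (ℬ : Finset E → Prop) : Prop :=
  ∀ B : Finset E, ℬ B ↔ B.card = d ∧ LinearIndependent ℝ (fun j : B => fun i => A i j.1)

/-- A positroid of rank `d` on the finite linearly ordered ground set `E`,
given by its collection of bases `ℬ`. -/
def IsPositroidOfRank (d : ℕ) {E : Type*} [Fintype E] [LinearOrder E]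
    (ℬ : Finset E → Prop) : Prop :=
  ∃ A : Matrix (Fin d) E ℝ, A.TotallyNonneg ∧ A.RepresentsBases ℬ

/-- A positroid on the finite linearly ordered ground set `E`. -/
def IsPositroid {E : Type*} [Fintype E] [LinearOrder E] (ℬ : Finset E → Prop) : Prop :=
  ∃ d, IsPositroidOfRank d ℬ


/-- The number of positroids on `[n]`, each positroid identified with its
(finite) collection of bases. -/
noncomputable def numPositroids (n : ℕ) : ℕ :=
  Nat.card {ℬ : Finset (Finset (Fin n)) // IsPositroid (fun B => B ∈ ℬ)}


namespace Positroid

variable {E : Type} [AddCommGroup E] [Module ℝ E]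

/-- alternating multilinear functions on lists -/
structure IsAlt (f : List E → ℝ) : Prop where
  add : ∀ l₁ x y l₂, f (l₁ ++ (x + y) :: l₂) = f (l₁ ++ x :: l₂) + f (l₁ ++ y :: l₂)
  smul : ∀ l₁ (c : ℝ) x l₂, f (l₁ ++ (c • x) :: l₂) = c * f (l₁ ++ x :: l₂)
  alt : ∀ l₁ x l₂, f (l₁ ++ x :: x :: l₂) = 0

/-- the determinant of a list of functionals against a list of vectors -/
noncomputable def G (R : List (E →ₗ[ℝ] ℝ)) (V : List E) : ℝ :=
  if R.length = V.length then
    Matrix.det (Matrix.of fun i j : Fin R.length => (R.getD i 0) (V.getD j 0)) else 0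

namespace IsAlt

/-- one slot as a linear map -/
def toLin {f : List E → ℝ} (hf : IsAlt f) (l₁ l₂ : List E) : E →ₗ[ℝ] ℝ where
  toFun x := f (l₁ ++ x :: l₂)
  map_add' x y := hf.add l₁ x y l₂
  map_smul' c x := by simpa using hf.smul l₁ c x l₂

theorem toLin_apply {f : List E → ℝ} (hf : IsAlt f) (l₁ l₂ : List E) (x : E) :
    hf.toLin l₁ l₂ x = f (l₁ ++ x :: l₂) := rfl


theorem zero {f : List E → ℝ} (hf : IsAlt f) (l₁ l₂ : List E) : f (l₁ ++ 0 :: l₂) = 0 := (hf.toLin l₁ l₂).map_zero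

theorem neg {f : List E → ℝ} (hf : IsAlt f) (l₁ : List E) (x) (l₂ : List E) : f (l₁ ++ (-x) :: l₂) = - f (l₁ ++ x :: l₂) :=
  (hf.toLin l₁ l₂).map_neg x

theorem sub {f : List E → ℝ} (hf : IsAlt f) (l₁ : List E) (x y) (l₂ : List E) :
    f (l₁ ++ (x - y) :: l₂) = f (l₁ ++ x :: l₂) - f (l₁ ++ y :: l₂) :=
  (hf.toLin l₁ l₂).map_sub x y

theorem swap {f : List E → ℝ} (hf : IsAlt f) (l₁ : List E) (x y) (l₂ : List E) :
    f (l₁ ++ x :: y :: l₂) = - f (l₁ ++ y :: x :: l₂) := by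
  have h := hf.alt l₁ (x + y) l₂
  rw [hf.add] at h
  have h1 : ∀ z w : E, f (l₁ ++ z :: w :: l₂) = f ((l₁ ++ [z]) ++ w :: l₂) := by
    intro z w; simp
  rw [h1, h1, hf.add, hf.add, ← h1, ← h1, ← h1, ← h1, hf.alt, hf.alt] at h
  linarith

theorem perm_aux {f : List E → ℝ} (hf : IsAlt f) {l l' : List E} (h : l.Perm l') : ∀ pre, f (pre ++ l) = 0 ↔ f (pre ++ l') = 0 := by
  induction h with
  | nil => intro pre; rfl
  | cons x _ ih => intro pre; simpa using ih (pre ++ [x])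
  | swap x y l => intro pre; rw [hf.swap]; simp
  | trans _ _ ih1 ih2 => intro pre; rw [ih1, ih2]

theorem perm {f : List E → ℝ} (hf : IsAlt f) {l l' : List E} (h : l.Perm l') : f l = 0 ↔ f l' = 0 := hf.perm_aux h []

theorem of_mem {f : List E → ℝ} (hf : IsAlt f) {l₁ l₂ : List E} {x : E} (h : x ∈ l₁ ++ l₂) : f (l₁ ++ x :: l₂) = 0 := by
  have h1 : (l₁ ++ x :: l₂).Perm (x :: (l₁ ++ l₂)) := List.perm_middle
  classical
  have h2 := List.perm_cons_erase h
  rw [hf.perm (h1.trans (h2.cons x))]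
  exact hf.alt [] x _

theorem of_span {f : List E → ℝ} (hf : IsAlt f) {l₁ l₂ : List E} {x : E} (h : x ∈ Submodule.span ℝ {y | y ∈ l₁ ++ l₂}) :
    f (l₁ ++ x :: l₂) = 0 := by
  have : Submodule.span ℝ {y | y ∈ l₁ ++ l₂} ≤ LinearMap.ker (hf.toLin l₁ l₂) := by
    rw [Submodule.span_le]
    intro y hy
    exact hf.of_mem hy
  exact this h

theorem add_mem {f : List E → ℝ} (hf : IsAlt f) {l₁ l₂ : List E} {x y : E} (c : ℝ) (h : x ∈ l₁ ++ l₂) :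
    f (l₁ ++ (y + c • x) :: l₂) = f (l₁ ++ y :: l₂) := by
  rw [hf.add, hf.smul, hf.of_mem h]; simp

/-- moving a vector to the left -/
theorem move {f : List E → ℝ} (hf : IsAlt f) (l₀ l₁ : List E) (x : E) (l₂ : List E) :
    f (l₀ ++ l₁ ++ x :: l₂) = f (l₀ ++ x :: (l₁.map (fun y => -y) ++ l₂)) := by
  induction l₁ generalizing l₀ with
  | nil => simp
  | cons y l ih =>
    have h := ih (l₀ ++ [y])
    simp only [List.append_assoc, List.singleton_append, List.map_cons, List.cons_append] at h ⊢
    simp only [List.nil_append] at h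
    rw [h]
    rw [hf.swap]
    have h2 := hf.neg (l₀ ++ [x]) y (l.map (fun y => -y) ++ l₂)
    simp only [List.append_assoc, List.singleton_append, List.cons_append, List.nil_append] at h2
    rw [h2]

/-- moving a vector to the right end -/
theorem move' {f : List E → ℝ} (hf : IsAlt f) (l₁ l₂ : List E) (e : E) :
    f (l₁ ++ l₂.map (fun y => -y) ++ [e]) = f (l₁ ++ e :: l₂) := by
  rw [hf.move]
  simp [Function.comp_def]

theorem smul_scale {f : List E → ℝ} (hf : IsAlt f) (c : ℝ) (pre l : List E) : 
    f (pre ++ l.map (fun y => c • y)) = c ^ l.length * f (pre ++ l) := by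
  induction l generalizing pre with
  | nil => simp
  | cons y l ih =>
    rw [List.map_cons, hf.smul]
    have := ih (pre ++ [y])
    simp only [List.append_assoc, List.singleton_append] at this
    rw [this, List.length_cons]; ring

/-- adding multiples of a present vector to a block -/
theorem add_block {f : List E → ℝ} (hf : IsAlt f) (l₀ l : List E) (c : E → ℝ) (x : E) (l₂ : List E) (h : x ∈ l₀ ++ l₂) :
    f (l₀ ++ l.map (fun y => y + c y • x) ++ l₂) = f (l₀ ++ l ++ l₂) := by
  induction l generalizing l₀ with
  | nil => simp
  | cons y l ih =>
    have h1 : x ∈ l₀ ++ (l.map (fun y => y + c y • x) ++ l₂) := by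
      simp only [List.mem_append] at h ⊢; tauto
    have h2 := hf.add_mem (y := y) (c y) h1
    have h3 := ih (l₀ ++ [y]) (by simp only [List.mem_append] at h ⊢; tauto)
    simp only [List.append_assoc, List.singleton_append, List.map_cons, List.cons_append] at *
    rw [h2]
    exact h3

theorem span_zero_aux {f : List E → ℝ} (hf : IsAlt f) {S : Set E} (h : ∀ l : List E, (∀ x ∈ l, x ∈ S) → f l = 0) :
    ∀ (l : List E), (∀ x ∈ l, x ∈ Submodule.span ℝ S) → ∀ pre : List E, (∀ x ∈ pre, x ∈ S) →
      f (pre ++ l) = 0 := by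
  intro l
  induction l with
  | nil => intro _ pre hp; simpa using h pre hp
  | cons y l ih =>
    intro hl pre hp
    have : Submodule.span ℝ S ≤ LinearMap.ker (hf.toLin pre l) := by
      rw [Submodule.span_le]
      intro z hz
      have := ih (fun x hx => hl x (by simp [hx])) (pre ++ [z]) (by
        intro x hx
        simp only [List.mem_append, List.mem_singleton] at hx
        rcases hx with hx | rfl
        · exact hp x hx
        · exact hz)
      rw [SetLike.mem_coe, LinearMap.mem_ker, hf.toLin_apply]
      simpa using this
    exact this (hl y (by simp))

/-- vanishing on sublists gives vanishing on the span -/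
theorem span_zero {f : List E → ℝ} (hf : IsAlt f) {A : List E} (h : ∀ l : List E, l.Sublist A → f l = 0) (l : List E)
    (hl : ∀ x ∈ l, x ∈ Submodule.span ℝ {y | y ∈ A}) : f l = 0 := by
  have := hf.span_zero_aux (S := {y | y ∈ A}) ?_ l hl [] (by simp)
  · simpa using this
  intro l hl
  by_cases hn : l.Nodup
  · obtain ⟨l', h1, h2⟩ := List.subperm_of_subset hn (fun x hx => hl x hx)
    rw [← hf.perm h1]; exact h l' h2
  · rw [← List.exists_duplicate_iff_not_nodup] at hn
    obtain ⟨x, hx⟩ := hn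
    rw [List.duplicate_iff_sublist] at hx
    obtain ⟨r, hr⟩ := hx.exists_perm_append
    rw [hf.perm hr]
    exact hf.alt [] x r

theorem contract {f : List E → ℝ} (hf : IsAlt f) (e : E) : IsAlt (fun l => f (l ++ [e])) where
  add l₁ x y l₂ := by simpa using hf.add l₁ x y (l₂ ++ [e])
  smul l₁ c x l₂ := by simpa using hf.smul l₁ c x (l₂ ++ [e])
  alt l₁ x l₂ := by simpa using hf.alt l₁ x (l₂ ++ [e])

end IsAlt

theorem G_length {R : List (E →ₗ[ℝ] ℝ)} {V : List E} (h : G R V ≠ 0) : R.length = V.length := by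
  unfold G at h
  by_contra h'
  simp [h'] at h

theorem G_eq {n : ℕ} {R : List (E →ₗ[ℝ] ℝ)} {V : List E} (h : R.length = n) (h' : V.length = n) :
    G R V = Matrix.det (Matrix.of fun i j : Fin n => (R.getD i 0) (V.getD j 0)) := by
  subst h
  simp [G, h']

theorem G_transpose (R : List (E →ₗ[ℝ] ℝ)) (V : List E) :
    G R V = G (V.map (Module.Dual.eval ℝ E)) R := by
  by_cases h : R.length = V.length
  · rw [G_eq h rfl, G_eq (n := V.length) (by simp) h, ← Matrix.det_transpose]
    congr 1
    ext i j
    have : (V.map (Module.Dual.eval ℝ E)).getD (i : ℕ) 0 = Module.Dual.eval ℝ E (V.getD i 0) := by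
      rw [List.getD_eq_getElem?_getD, List.getD_eq_getElem?_getD]
      simp
    simp only [Matrix.transpose_apply, Matrix.of_apply, this]
    rfl
  · have h' : ¬ (V.map (Module.Dual.eval ℝ E)).length = R.length := by
      simpa [eq_comm] using h
    unfold G
    rw [if_neg h, if_neg h']

theorem G_slot (R : List (E →ₗ[ℝ] ℝ)) (l₁ l₂ : List E) (h : R.length = l₁.length + l₂.length + 1) :
    ∃ (M : Matrix (Fin R.length) (Fin R.length) ℝ) (k : Fin R.length), ∀ x,
      G R (l₁ ++ x :: l₂) = (M.updateCol k (fun i => R.getD i 0 x)).det := by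
  refine ⟨Matrix.of fun i j => (R.getD i 0) ((l₁ ++ 0 :: l₂).getD j 0), ⟨l₁.length, by omega⟩, ?_⟩
  intro x
  rw [G_eq (n := R.length) rfl (by simp; omega)]
  congr 1
  ext i j
  rw [Matrix.updateCol_apply]
  split_ifs with hj
  · subst hj
    simp [List.getD_eq_getElem?_getD]
  · have hj' : (j : ℕ) ≠ l₁.length := fun h => hj (Fin.ext h)
    simp only [Matrix.of_apply, List.getD_eq_getElem?_getD]
    congr 2
    rcases lt_or_gt_of_ne hj' with h1 | h1
    · rw [List.getElem?_append_left h1, List.getElem?_append_left h1]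
    · rw [List.getElem?_append_right h1.le, List.getElem?_append_right h1.le]
      obtain ⟨d, hd⟩ : ∃ d, (j : ℕ) - l₁.length = d + 1 := ⟨(j : ℕ) - l₁.length - 1, by omega⟩
      rw [hd]; simp

theorem G_isAlt (R : List (E →ₗ[ℝ] ℝ)) : IsAlt (G R) where
  add l₁ x y l₂ := by
    by_cases h : R.length = l₁.length + l₂.length + 1
    · obtain ⟨M, k, hM⟩ := G_slot R l₁ l₂ h
      rw [hM, hM, hM, ← Matrix.det_updateCol_add]
      congr 2
      ext i; simp
    · have : ∀ z : E, G R (l₁ ++ z :: l₂) = 0 := fun z => by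
        by_contra h'; have := G_length h'; simp at this; omega
      simp [this]
  smul l₁ c x l₂ := by
    by_cases h : R.length = l₁.length + l₂.length + 1
    · obtain ⟨M, k, hM⟩ := G_slot R l₁ l₂ h
      rw [hM, hM, ← Matrix.det_updateCol_smul]
      congr 2
      ext i; simp
    · have : ∀ z : E, G R (l₁ ++ z :: l₂) = 0 := fun z => by
        by_contra h'; have := G_length h'; simp at this; omega
      simp [this]
  alt l₁ x l₂ := by
    by_contra h'
    have h := G_length h'
    apply h'
    rw [G_eq h.symm.symm rfl]
    simp only [List.length_append, List.length_cons] at h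
    refine Matrix.det_zero_of_column_eq (i := ⟨l₁.length, by simp⟩)
      (j := ⟨l₁.length + 1, by simp⟩) (by simp) ?_
    intro i
    simp [List.getD_eq_getElem?_getD]

theorem G_isAlt' (V : List E) : IsAlt (fun R => G R V) := by
  have : (fun R => G R V) = G (V.map (Module.Dual.eval ℝ E)) := by
    ext R; exact G_transpose R V
  rw [this]
  exact G_isAlt _

/-- solving linear systems -/
theorem G_solve {R : List (E →ₗ[ℝ] ℝ)} {V : List E} (h : G R V ≠ 0) (x : E) :
    ∃ y ∈ Submodule.span ℝ {z | z ∈ V}, ∀ ρ ∈ R, ρ x = ρ y := by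
  have hl := G_length h
  rw [G_eq rfl hl.symm] at h
  set M := (Matrix.of fun i j : Fin R.length => (R.getD i 0) (V.getD j 0)) with hM
  have hu : IsUnit M.det := isUnit_iff_ne_zero.mpr h
  set b : Fin R.length → ℝ := fun i => R.getD i 0 x
  set c := M⁻¹.mulVec b
  have hc : M.mulVec c = b := by
    simp [c, Matrix.mulVec_mulVec, Matrix.mul_nonsing_inv _ hu]
  refine ⟨∑ j, c j • V.getD j 0, ?_, ?_⟩
  · refine Submodule.sum_mem _ (fun j _ => Submodule.smul_mem _ _ (Submodule.subset_span ?_))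
    have : (j : ℕ) < V.length := by omega
    simp [List.getD_eq_getElem?_getD, this]
  · intro ρ hρ
    obtain ⟨i, hi, rfl⟩ := List.getElem_of_mem hρ
    have := congrFun hc ⟨i, hi⟩
    simp only [Matrix.mulVec, dotProduct, hM, Matrix.of_apply, b, List.getD_eq_getElem?_getD, List.getElem?_eq_getElem hi, Option.getD_some] at this
    rw [map_sum, ← this]
    refine Finset.sum_congr rfl fun j _ => ?_
    simp [List.getD_eq_getElem?_getD, mul_comm]

theorem G_solve' {R : List (E →ₗ[ℝ] ℝ)} {V : List E} (h : G R V ≠ 0) (σ : E →ₗ[ℝ] ℝ) :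
    ∃ ν ∈ Submodule.span ℝ {z | z ∈ R}, ∀ v ∈ V, σ v = ν v := by
  rw [G_transpose] at h
  obtain ⟨y, hy, h2⟩ := G_solve h σ
  refine ⟨y, hy, fun v hv => ?_⟩
  exact h2 (Module.Dual.eval ℝ E v) (List.mem_map_of_mem hv)

/-- Laplace along the first row -/
theorem G_laplace (a : E →ₗ[ℝ] ℝ) (R : List (E →ₗ[ℝ] ℝ)) (V : List E) (h : V.length = R.length + 1) :
    G (a :: R) V = ∑ j : Fin (R.length + 1),
      (-1) ^ (j : ℕ) * a (V.getD j 0) * G R (V.eraseIdx j) := by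
  rw [G_eq (n := R.length + 1) (by simp) h, Matrix.det_succ_row_zero]
  refine Finset.sum_congr rfl fun j _ => ?_
  rw [G_eq (n := R.length) rfl (by rw [List.length_eraseIdx]; have := j.2; simp [h]; omega)]
  congr 2
  ext i k
  simp only [Matrix.submatrix_apply, Matrix.of_apply, Fin.val_succ, List.getD_cons_succ]
  congr 1
  simp only [List.getD_eq_getElem?_getD, List.getElem?_eraseIdx]
  congr 1
  split_ifs with hk
  · rw [Fin.succAbove_of_castSucc_lt _ _ (by simpa [Fin.lt_def] using hk)]; simp
  · rw [Fin.succAbove_of_le_castSucc _ _ (by simpa [Fin.le_def] using hk)]; simp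

theorem G_nil : G ([] : List (E →ₗ[ℝ] ℝ)) [] = 1 := by simp [G]

theorem G_one (a : E →ₗ[ℝ] ℝ) (x : E) : G [a] [x] = a x := by
  rw [G_laplace _ _ _ (by simp)]; simp [G_nil]

theorem G_row (a : E →ₗ[ℝ] ℝ) (R : List (E →ₗ[ℝ] ℝ)) (x : E) (V : List E) (h : ∀ v ∈ V, a v = 0) :
    G (a :: R) (x :: V) = a x * G R V := by
  by_cases hl : V.length = R.length
  · rw [G_laplace _ _ _ (by simp [hl]), Fin.sum_univ_succ]
    rw [Finset.sum_eq_zero, add_zero]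
    · simp
    · intro j _
      have : (j : ℕ) < V.length := by omega
      have h0 : a (V.getD j 0) = 0 := by
        apply h; simp [List.getD_eq_getElem?_getD, this]
      simp [List.getD_eq_getElem?_getD] at h0 ⊢
      simp [h0]
  · have h1 : G R V = 0 := by
      by_contra h'; exact hl (G_length h').symm
    have h2 : G (a :: R) (x :: V) = 0 := by
      by_contra h'; have := G_length h'; simp at this; omega
    rw [h1, h2]; simp

theorem G_col (a : E →ₗ[ℝ] ℝ) (R : List (E →ₗ[ℝ] ℝ)) (x : E) (V : List E) (h : ∀ b ∈ R, b x = 0) :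
    G (a :: R) (x :: V) = a x * G R V := by
  rw [G_transpose, List.map_cons, G_row, ← G_transpose]
  · rfl
  · intro v hv; exact h v hv

theorem G_exists (R₁ : List (E →ₗ[ℝ] ℝ)) (a) (R₂ : List (E →ₗ[ℝ] ℝ)) (V : List E)
    (h : G (R₁ ++ a :: R₂) V ≠ 0) :
    ∃ V₁ c V₂, V = V₁ ++ c :: V₂ ∧ G (R₁ ++ R₂) (V₁ ++ V₂) ≠ 0 := by
  have hl := G_length h
  have h2 : G (a :: (R₁ ++ R₂)) V ≠ 0 := by
    intro h3
    exact h (((G_isAlt' V).perm List.perm_middle).mpr h3)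
  rw [G_laplace _ _ _ (by simp at hl ⊢; omega)] at h2
  obtain ⟨j, _, hj⟩ := Finset.exists_ne_zero_of_sum_ne_zero h2
  have hj2 : (j : ℕ) < V.length := by have := j.2; simp at hl this; omega
  refine ⟨V.take j, V[(j : ℕ)], V.drop (j + 1), ?_, ?_⟩
  · simp
  · rw [List.eraseIdx_eq_take_drop_succ] at hj
    exact right_ne_zero_of_mul hj

theorem G_neg (R : List (E →ₗ[ℝ] ℝ)) (V : List E) :
    G (R.map (fun β => -β)) V = G R (V.map (fun x => -x)) := by
  unfold G
  simp only [List.length_map]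
  split_ifs with h
  · have h1 : ∀ i, (R.map (fun β => -β)).getD i 0 = - R.getD i 0 := by
      intro i; simp only [List.getD_eq_getElem?_getD, List.getElem?_map]
      cases R[i]? <;> simp
    have h2 : ∀ i, (V.map (fun β => -β)).getD i 0 = - V.getD i 0 := by
      intro i; simp only [List.getD_eq_getElem?_getD, List.getElem?_map]
      cases V[i]? <;> simp
    rw [← Matrix.det_submatrix_equiv_self (finCongr (by simp : R.length = (R.map (fun β => -β)).length))]
    congr 1
    ext i j
    simp only [Matrix.submatrix_apply, Matrix.of_apply, finCongr_apply, Fin.val_cast]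
    rw [h1, h2]; simp
  · rfl

/-- `G` only depends on the values -/
theorem G_congr {R : List (E →ₗ[ℝ] ℝ)} {V : List E} (g : (E →ₗ[ℝ] ℝ) → (E →ₗ[ℝ] ℝ))
    (h : ∀ β ∈ R, ∀ v ∈ V, g β v = β v) : G (R.map g) V = G R V := by
  by_cases hl : R.length = V.length
  · rw [G_eq (n := R.length) (by simp) hl.symm, G_eq rfl hl.symm]
    congr 1
    ext i j
    have hi : (i : ℕ) < R.length := i.2
    have hj : (j : ℕ) < V.length := by omega
    simp [List.getD_eq_getElem?_getD, hj]
    exact h _ (List.getElem_mem _) _ (List.getElem_mem _)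
  · unfold G
    rw [if_neg hl, if_neg (by simpa using hl)]

end Positroid


namespace Positroid

variable {E : Type} [AddCommGroup E] [Module ℝ E]

/-- nonnegativity on all sublists -/
def NN (f : List E → ℝ) (L : List E) : Prop := ∀ l : List E, l.Sublist L → 0 ≤ f l

theorem NN.mono {f : List E → ℝ} {L L' : List E} (h : NN f L') (hL : L.Sublist L') : NN f L :=
  fun l hl => h l (hl.trans hL)

/-- total nonnegativity of a list of functionals against a list of vectors -/
def TN (R : List (E →ₗ[ℝ] ℝ)) (V : List E) : Prop :=
  ∀ r : List (E →ₗ[ℝ] ℝ), r.Sublist R → ∀ c : List E, c.Sublist V → 0 ≤ G r c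

theorem whitney_aux {pre post : List (E →ₗ[ℝ] ℝ)} {ρ σ : E →ₗ[ℝ] ℝ} {v : E} {V : List E}
    (h : TN (pre ++ ρ :: σ :: post) (v :: V)) (hρ : ρ v = 1) (hσ : σ v = 1)
    (hp : ∀ b ∈ post, b v = 0) (R₂ : List (E →ₗ[ℝ] ℝ)) (h2 : R₂.Sublist post) :
    ∀ (n : ℕ) (R₁ : List (E →ₗ[ℝ] ℝ)), R₁.length = n → R₁.Sublist pre → ∀ c : List E, c.Sublist (v :: V) →
      G (R₁ ++ ρ :: R₂) c ≤ G (R₁ ++ σ :: R₂) c := by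
  intro n
  induction n with
  | zero =>
    intro R₁ hn _ c hc
    obtain rfl := List.eq_nil_of_length_eq_zero hn
    have hsub := (G_isAlt' c).sub [] σ ρ R₂
    simp only [List.nil_append] at hsub ⊢
    suffices h0 : 0 ≤ G ((σ - ρ) :: R₂) c by linarith
    have hR2 : ∀ b ∈ R₂, b v = 0 := fun b hb => hp b (h2.subset hb)
    rcases List.sublist_cons_iff.mp hc with hc' | ⟨c', rfl, hc'⟩
    · have h3 := h (ρ :: σ :: R₂) ((((h2.cons_cons σ).cons_cons ρ)).trans (List.sublist_append_right _ _))
        (v :: c) (hc'.cons_cons v)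
      have h4 := (G_isAlt' (v :: c)).add_mem (l₁ := [ρ]) (l₂ := R₂) (x := ρ) (y := σ) (-1) (by simp)
      simp only [List.singleton_append] at h4
      rw [← h4, G_col, hρ, one_mul] at h3
      · convert h3 using 2; simp [sub_eq_add_neg]
      · intro b hb
        rcases List.mem_cons.mp hb with rfl | hb
        · simp [hρ, hσ]
        · exact hR2 b hb
    · rw [G_col _ _ _ _ hR2]; simp [hρ, hσ]
  | succ n ih =>
    intro R₁ hn h1 c hc
    obtain ⟨R, a, rfl⟩ : ∃ R a, R₁ = R ++ [a] := by
      rcases List.eq_nil_or_concat R₁ with rfl | ⟨R, a, rfl⟩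
      · simp at hn
      · exact ⟨R, a, by simp⟩
    have hRl : R.length = n := by simpa using hn
    have hRs : R.Sublist pre := (List.sublist_append_left R [a]).trans h1
    simp only [List.append_assoc, List.singleton_append, List.cons_append, List.nil_append]
    have hall : ∀ (r : List (E →ₗ[ℝ] ℝ)), r.Sublist [a, ρ, σ] →
        ∀ d : List E, d.Sublist (v :: V) → 0 ≤ G (R ++ r ++ R₂) d := by
      intro r hr d hd
      refine h _ ?_ d hd
      have h5 : (R ++ [a]).Sublist pre := h1
      have e1 : (R ++ r ++ R₂).Sublist ((R ++ [a, ρ, σ]) ++ post) := (hr.append_left R).append h2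
      refine e1.trans ?_
      have e2 : ((R ++ [a]) ++ (ρ :: σ :: post)).Sublist (pre ++ ρ :: σ :: post) := h5.append_right _
      simpa using e2
    have p1 : 0 ≤ G (R ++ a :: ρ :: R₂) c := by
      simpa using hall [a, ρ] (by simp) c hc
    have p2 : 0 ≤ G (R ++ a :: σ :: R₂) c := by
      simpa using hall [a, σ] (by simp) c hc
    rcases p1.eq_or_lt with p1 | p1
    · rw [← p1]; exact p2
    have hne := p1.ne'
    obtain ⟨c₁, x, c₂, rfl, hD⟩ := G_exists R a (ρ :: R₂) c hne
    set C := c₁ ++ x :: c₂ with hC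
    set D := c₁ ++ c₂ with hDdef
    have hDC : D.Sublist C := (List.sublist_cons_self x c₂).append_left c₁
    have hDs : D.Sublist (v :: V) := hDC.trans hc
    have q1 : 0 < G (R ++ ρ :: R₂) D :=
      lt_of_le_of_ne (by simpa using hall [ρ] (by simp) D hDs) (Ne.symm hD)
    have q2 : 0 ≤ G (R ++ a :: R₂) D := by simpa using hall [a] (by simp) D hDs
    have q3 : 0 ≤ G (R ++ ρ :: σ :: R₂) C := by simpa using hall [ρ, σ] (by simp) C hc
    have q4 := ih R hRl hRs D hDs
    obtain ⟨ν, hν, hνV⟩ := G_solve' hne σ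
    have hset : {z | z ∈ R ++ a :: ρ :: R₂} = insert a (insert ρ {z | z ∈ R ++ R₂}) := by
      ext z; simp; tauto
    rw [hset, Submodule.mem_span_insert] at hν
    obtain ⟨α, ν1, hν1, rfl⟩ := hν
    rw [Submodule.mem_span_insert] at hν1
    obtain ⟨τ, ν2, hν2, rfl⟩ := hν1
    -- replace σ
    have key : ∀ (d : List E), (∀ y ∈ d, y ∈ C) → ∀ l₁ l₂ : List (E →ₗ[ℝ] ℝ),
        (∀ z ∈ R ++ R₂, z ∈ l₁ ++ l₂) →
        G (l₁ ++ σ :: l₂) d = α * G (l₁ ++ a :: l₂) d + τ * G (l₁ ++ ρ :: l₂) d := by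
      intro d hd l₁ l₂ hl
      have alt := G_isAlt' d
      have e1 : G (l₁ ++ (σ - (α • a + (τ • ρ + ν2))) :: l₂) d = 0 := by
        by_contra hne'
        have := (G_isAlt' d).perm (l := l₁ ++ (σ - (α • a + (τ • ρ + ν2))) :: l₂) List.perm_middle
        apply hne'
        rw [this]
        have hlen : d.length = (l₁ ++ l₂).length + 1 := by
          have := G_length hne'; simp at this ⊢; omega
        rw [G_laplace _ _ _ hlen]
        refine Finset.sum_eq_zero fun j _ => ?_
        have hj : (j : ℕ) < d.length := by have := j.2; omega
        have : (d.getD j 0) ∈ d := by simp [List.getD_eq_getElem?_getD, hj]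
        have := hνV _ (hd _ this)
        rw [LinearMap.sub_apply, this]; simp
      have e2 : G (l₁ ++ ν2 :: l₂) d = 0 :=
        alt.of_span (l₁ := l₁) (l₂ := l₂) (x := ν2) (Submodule.span_mono (fun z hz => hl z hz) hν2)
      rw [alt.sub, alt.add, alt.add, alt.smul, alt.smul, e2] at e1
      linarith
    have k1 := key C (fun _ h => h) (R ++ [a]) R₂ (by intro z; simp; tauto)
    have k2 := key D (fun _ h => hDC.subset h) R R₂ (by intro z; simp)
    have k3 := key C (fun _ h => h) (R ++ [ρ]) R₂ (by intro z; simp; tauto)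
    simp only [List.append_assoc, List.singleton_append, List.cons_append, List.nil_append] at k1 k3
    rw [(G_isAlt' C).alt, mul_zero, zero_add] at k1
    rw [(G_isAlt' C).alt R ρ R₂, mul_zero, add_zero, (G_isAlt' C).swap R ρ a R₂] at k3
    rw [k1]
    -- α ≤ 0 or q2 = 0
    have hα : α ≤ 0 := by
      by_contra hα
      push Not at hα
      nlinarith
    have : 1 ≤ τ := by
      by_contra hτ
      push Not at hτ
      nlinarith [mul_nonneg (neg_nonneg.mpr hα) q2]
    nlinarith

theorem whitney {pre post : List (E →ₗ[ℝ] ℝ)} {ρ σ : E →ₗ[ℝ] ℝ} {v : E} {V : List E}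
    (h : TN (pre ++ ρ :: σ :: post) (v :: V)) (hρ : ρ v = 1) (hσ : σ v = 1)
    (hp : ∀ b ∈ post, b v = 0) : TN (pre ++ ρ :: (σ - ρ) :: post) (v :: V) := by
  intro r hr c hc
  obtain ⟨R₁, r', rfl, h1, hr'⟩ := List.sublist_append_iff.mp hr
  rcases List.sublist_cons_iff.mp hr' with hr'' | ⟨r'', rfl, hr''⟩
  · rcases List.sublist_cons_iff.mp hr'' with h2 | ⟨R₂, rfl, h2⟩
    · exact h _ (h1.append (h2.trans (by simp))) c hc
    · have := whitney_aux h hρ hσ hp R₂ h2 _ R₁ rfl h1 c hc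
      rw [(G_isAlt' c).sub]; linarith
  · rcases List.sublist_cons_iff.mp hr'' with h2 | ⟨R₂, rfl, h2⟩
    · exact h _ (h1.append ((h2.trans (by simp)).cons_cons ρ)) c hc
    · have h3 := h (R₁ ++ ρ :: σ :: R₂) (h1.append ((h2.cons_cons σ).cons_cons ρ)) c hc
      have h4 := (G_isAlt' c).add_mem (l₁ := R₁ ++ [ρ]) (l₂ := R₂) (x := ρ) (y := σ) (-1) (by simp)
      simp only [List.append_assoc, List.singleton_append, List.cons_append, List.nil_append] at h4
      rw [← h4] at h3
      convert h3 using 4; simp [sub_eq_add_neg]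

end Positroid


namespace Positroid

variable {E : Type} [AddCommGroup E] [Module ℝ E]

theorem TN.mono {R R' : List (E →ₗ[ℝ] ℝ)} {V V' : List E} (h : TN R' V') (hR : R.Sublist R')
    (hV : V.Sublist V') : TN R V :=
  fun r hr c hc => h r (hr.trans hR) c (hc.trans hV)

theorem TN.scale {pre post : List (E →ₗ[ℝ] ℝ)} {ρ : E →ₗ[ℝ] ℝ} {V : List E} {a : ℝ}
    (h : TN (pre ++ ρ :: post) V) (ha : 0 ≤ a) : TN (pre ++ (a • ρ) :: post) V := by
  intro r hr c hc
  obtain ⟨R₁, r', rfl, h1, hr'⟩ := List.sublist_append_iff.mp hr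
  rcases List.sublist_cons_iff.mp hr' with h2 | ⟨R₂, rfl, h2⟩
  · exact h _ (h1.append (h2.trans (by simp))) c hc
  · rw [(G_isAlt' c).smul]
    exact mul_nonneg ha (h _ (h1.append (h2.cons_cons ρ)) c hc)

theorem TN.nonneg {R : List (E →ₗ[ℝ] ℝ)} {V : List E} (h : TN R V) {ρ : E →ₗ[ℝ] ℝ} {x : E}
    (hr : ρ ∈ R) (hx : x ∈ V) : 0 ≤ ρ x := by
  rw [← G_one]; exact h _ (by simpa using hr) _ (by simpa using hx)

theorem G_two (ρ σ : E →ₗ[ℝ] ℝ) (x y : E) : G [ρ, σ] [x, y] = ρ x * σ y - ρ y * σ x := by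
  rw [G_laplace _ _ _ (by simp)]
  refine (Fin.sum_univ_two _).trans ?_
  simp [G_one]; ring

/-- the functionals in a list of dual pairs -/
abbrev bs (Z : List (E × (E →ₗ[ℝ] ℝ))) : List (E →ₗ[ℝ] ℝ) := Z.map Prod.snd

/-- the vectors in a list of dual pairs -/
abbrev ws (Z : List (E × (E →ₗ[ℝ] ℝ))) : List E := Z.map Prod.fst

inductive RedP (v : E) : List (E × (E →ₗ[ℝ] ℝ)) → List Bool → (E × (E →ₗ[ℝ] ℝ)) →
    List (E × (E →ₗ[ℝ] ℝ)) → Prop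
  | start (w : E) (β : E →ₗ[ℝ] ℝ) (l : List (E × (E →ₗ[ℝ] ℝ))) : 0 < β v → (∀ z ∈ l, z.2 v = 0) →
      RedP v ((w, β) :: l) [] (β v • w, (β v)⁻¹ • β) l
  | skip (z : E × (E →ₗ[ℝ] ℝ)) (l : List (E × (E →ₗ[ℝ] ℝ))) (s : List Bool) (y) (l') :
      RedP v l s y l' → z.2 v = 0 → RedP v (z :: l) (false :: s) y l'
  | add (w : E) (β : E →ₗ[ℝ] ℝ) (l : List (E × (E →ₗ[ℝ] ℝ))) (s : List Bool) (y) (l') :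
      RedP v l s y l' → 0 < β v →
      RedP v ((w, β) :: l) (true :: s) (β v • w + y.1, (β v)⁻¹ • β)
        ((y.1, y.2 - (β v)⁻¹ • β) :: l')

namespace RedP

variable {v : E} {l l' : List (E × (E →ₗ[ℝ] ℝ))} {s : List Bool} {y : E × (E →ₗ[ℝ] ℝ)}

theorem val (h : RedP v l s y l') : y.2 v = 1 ∧ ∀ z ∈ l', z.2 v = 0 := by
  induction h with
  | start w β l hp h0 => exact ⟨by simp [hp.ne'], h0⟩
  | skip z l s y l' h h0 ih => exact ih
  | add w β l s y l' h hp ih => 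
    refine ⟨by simp [hp.ne'], ?_⟩
    intro z hz
    rcases List.mem_cons.mp hz with rfl | hz
    · simp [hp.ne', ih.1]
    · exact ih.2 z hz

theorem pos (h : RedP v l s y l') : ∃ z ∈ l, 0 < z.2 v := by
  induction h with
  | start w β l hp h0 => exact ⟨(w, β), by simp, hp⟩
  | skip z l s y l' h h0 ih => obtain ⟨z', h1, h2⟩ := ih; exact ⟨z', by simp [h1], h2⟩
  | add w β l s y l' h hp ih => exact ⟨(w, β), by simp, hp⟩

theorem nonneg (h : RedP v l s y l') : ∀ z ∈ l, 0 ≤ z.2 v := by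
  induction h with
  | start w β l hp h0 =>
    intro z hz
    rcases List.mem_cons.mp hz with rfl | hz
    · exact hp.le
    · exact (h0 z hz).ge
  | skip z l s y l' h h0 ih =>
    intro z' hz
    rcases List.mem_cons.mp hz with rfl | hz
    · exact h0.ge
    · exact ih z' hz
  | add w β l s y l' h hp ih =>
    intro z' hz
    rcases List.mem_cons.mp hz with rfl | hz
    · exact hp.le
    · exact ih z' hz

theorem length (h : RedP v l s y l') : s.length < l.length ∧
    l'.length + 1 = s.count true + (l.length - s.length) := by
  induction h with
  | start w β l hp h0 => simp
  | skip z l s y l' h h0 ih => simp; omega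
  | add w β l s y l' h hp ih => simp; omega

theorem sum (h : RedP v l s y l') : y.1 = (l.map fun z => z.2 v • z.1).sum := by
  induction h with
  | start w β l hp h0 =>
    have : (l.map fun z => z.2 v • z.1) = l.map (fun _ => (0:E)) :=
      List.map_congr_left fun z hz => by simp [h0 z hz]
    simp [this]
  | skip z l s y l' h h0 ih => simp [h0, ih]
  | add w β l s y l' h hp ih => simp [ih]

theorem memW (h : RedP v l s y l') (H : Submodule ℝ E) (hH : ∀ z ∈ l, z.1 ∈ H) :
    y.1 ∈ H ∧ ∀ z ∈ l', z.1 ∈ H := by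
  induction h with
  | start w β l hp h0 =>
    exact ⟨H.smul_mem _ (hH (w, β) (by simp)), fun z hz => hH z (by simp [hz])⟩
  | skip z l s y l' h h0 ih => exact ih fun z hz => hH z (by simp [hz])
  | add w β l s y l' h hp ih => 
    have ih := ih fun z hz => hH z (by simp [hz])
    refine ⟨H.add_mem (H.smul_mem _ (hH (w, β) (by simp))) ih.1, fun z hz => ?_⟩
    rcases List.mem_cons.mp hz with rfl | hz
    · exact ih.1
    · exact ih.2 z hz

theorem memB (h : RedP v l s y l') (H : Submodule ℝ (E →ₗ[ℝ] ℝ)) (hH : ∀ z ∈ l, z.2 ∈ H) :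
    y.2 ∈ H ∧ ∀ z ∈ l', z.2 ∈ H := by
  induction h with
  | start w β l hp h0 =>
    exact ⟨H.smul_mem _ (hH (w, β) (by simp)), fun z hz => hH z (by simp [hz])⟩
  | skip z l s y l' h h0 ih => exact ih fun z hz => hH z (by simp [hz])
  | add w β l s y l' h hp ih => 
    have ih := ih fun z hz => hH z (by simp [hz])
    have hb := (H.smul_mem (β v)⁻¹ (hH (w, β) (by simp)))
    refine ⟨hb, fun z hz => ?_⟩
    rcases List.mem_cons.mp hz with rfl | hz
    · exact H.sub_mem ih.1 hb
    · exact ih.2 z hz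

theorem tn (h : RedP v l s y l') : ∀ pre V, TN (pre ++ bs l) (v :: V) →
    TN (pre ++ y.2 :: bs l') (v :: V) := by
  induction h with
  | start w β l hp h0 => intro pre V h; exact TN.scale h (by positivity)
  | skip z l s y l' h h0 ih =>
    intro pre V h; refine ih _ _ (h.mono ?_ (List.Sublist.refl _)); simp
  | add w β l s y l' h hp ih =>
    intro pre V hT
    have h1 : TN (pre ++ ((β v)⁻¹ • β) :: bs l) (v :: V) := TN.scale hT (by positivity)
    have h2 := ih (pre ++ [(β v)⁻¹ • β]) V (by simpa using h1)
    have h3 : TN (pre ++ ((β v)⁻¹ • β) :: y.2 :: bs l') (v :: V) := by simpa using h2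
    refine whitney h3 (by simp [hp.ne']) h.val.1 ?_
    intro b hb
    obtain ⟨z, hz, rfl⟩ := List.mem_map.mp hb
    exact h.val.2 z hz

theorem rep (h : RedP v l s y l') (x : E) (hT : TN (bs l) [v, x]) :
    (l.map fun z => z.2 x • z.1).sum = ((y :: l').map fun z => z.2 x • z.1).sum := by
  induction h with
  | start w β l hp h0 =>
    simp [smul_smul]
    congr 1
    field_simp
  | skip z l s y l' h h0 ih =>
    obtain ⟨z', hz', hp⟩ := h.pos
    have h1 := hT [z.2, z'.2] (by simp; exact ⟨_, hz'⟩) [v, x] (List.Sublist.refl _)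
    rw [G_two] at h1
    have h2 := hT.nonneg (ρ := z.2) (x := x) (by simp) (by simp)
    have : z.2 x = 0 := by
      rw [h0] at h1; nlinarith
    rw [List.map_cons, List.sum_cons, this, zero_smul, zero_add]
    exact ih (hT.mono (by simp) (List.Sublist.refl _))
  | add w β l s y l' h hp ih =>
    rw [List.map_cons, List.sum_cons, ih (hT.mono (by simp) (List.Sublist.refl _))]
    simp [smul_smul, sub_smul]
    have : (β v)⁻¹ * β x * β v = β x := by field_simp
    rw [this]; abel

/-- duality of a list of pairs -/
def _root_.Positroid.DualL (Z : List (E × (E →ₗ[ℝ] ℝ))) : Prop :=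
  Z.Pairwise (fun z z' => z.2 z'.1 = 0 ∧ z'.2 z.1 = 0) ∧ ∀ z ∈ Z, z.2 z.1 = 1

theorem _root_.Positroid.DualL.tail {z : E × (E →ₗ[ℝ] ℝ)} {Z : List (E × (E →ₗ[ℝ] ℝ))}
    (h : DualL (z :: Z)) : DualL Z :=
  ⟨(List.pairwise_cons.mp h.1).2, fun z hz => h.2 z (by simp [hz])⟩

theorem dual (h : RedP v l s y l') (hd : DualL l) : DualL (y :: l') := by
  induction h with
  | start w β l hp h0 =>
    have h1 := List.pairwise_cons.mp hd.1
    have h2 := hd.2 (w, β) (by simp)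
    simp at h2
    refine ⟨List.pairwise_cons.mpr ⟨?_, h1.2⟩, ?_⟩
    · intro z hz
      have := h1.1 z hz
      simp at this
      simp [this]
    · intro z hz
      rcases List.mem_cons.mp hz with rfl | hz
      · simp [h2, hp.ne']
      · exact hd.2 z (by simp [hz])
  | skip z l s y l' h h0 ih => exact ih hd.tail
  | add w β l s y l' h hp ih =>
    have ih := ih hd.tail
    have h1 := List.pairwise_cons.mp hd.1
    have h2 := hd.2 (w, β) (by simp)
    simp at h2
    have h3 := h.memW (LinearMap.ker β) (fun z hz => (h1.1 z hz).1)
    have h4 := h.memB (LinearMap.ker (Module.Dual.eval ℝ E w)) (fun z hz => (h1.1 z hz).2)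
    simp only [LinearMap.mem_ker, Module.Dual.eval_apply] at h3 h4
    have h5 := List.pairwise_cons.mp ih.1
    have h6 := ih.2 y (by simp)
    refine ⟨List.pairwise_cons.mpr ⟨?_, List.pairwise_cons.mpr ⟨?_, h5.2⟩⟩, ?_⟩
    · intro z hz
      rcases List.mem_cons.mp hz with rfl | hz
      · simp [h3.1, h4.1, h6, h2, hp.ne']
      · simp [h3.2 z hz, h4.2 z hz, h5.1 z hz]
    · intro z hz
      simp [h3.2 z hz, h5.1 z hz]
    · intro z hz
      rcases List.mem_cons.mp hz with rfl | hz
      · simp [h3.1, h2, hp.ne']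
      · rcases List.mem_cons.mp hz with rfl | hz
        · simp [h3.1, h6]
        · exact ih.2 z (by simp [hz])

theorem exists_of (v : E) (l : List (E × (E →ₗ[ℝ] ℝ))) (h : ∀ z ∈ l, 0 ≤ z.2 v) :
    (∀ z ∈ l, z.2 v = 0) ∨ ∃ s y l', RedP v l s y l' := by
  induction l with
  | nil => left; simp
  | cons z l ih =>
    have hz : 0 ≤ z.2 v := h z (by simp)
    rcases ih (fun z hz => h z (by simp [hz])) with h0 | ⟨s, y, l', hr⟩
    · rcases hz.eq_or_lt with hz | hz
      · left; intro z' hz'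
        rcases List.mem_cons.mp hz' with rfl | hz'
        · exact hz.symm
        · exact h0 z' hz'
      · right; exact ⟨_, _, _, .start z.1 z.2 l hz h0⟩
    · right
      rcases hz.eq_or_lt with hz | hz
      · exact ⟨_, _, _, .skip z l s y l' hr hz.symm⟩
      · exact ⟨_, _, _, .add z.1 z.2 l s y l' hr hz⟩

end RedP

/-- The facts about a state of the reconstruction. -/
structure St (f : List E → ℝ) (H : Submodule ℝ E) (A : List E) (Z : List (E × (E →ₗ[ℝ] ℝ))) : Prop where
  alt : IsAlt f
  memA : ∀ x ∈ A, x ∈ H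
  memW : ∀ z ∈ Z, z.1 ∈ H
  basis : ∃ l : List E, l.Sublist A ∧ 0 < f l
  rep : ∀ v ∈ H, NN f (A ++ [v]) → v = (Z.map fun z => z.2 v • z.1).sum
  tn : ∀ V : List E, (∀ x ∈ V, x ∈ H) → NN f (A ++ V) → TN (bs Z) V
  dual : DualL Z

theorem St.pos {f : List E → ℝ} {H : Submodule ℝ E} {A : List E} {Z : List (E × (E →ₗ[ℝ] ℝ))}
    (h : St f H A Z) {v : E} {s y l} (hr : RedP v Z s y l) (hv : v ∈ H) (hy : y.1 = v) :
    St f H (A ++ [v]) (y :: l) where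
  alt := h.alt
  memA := by
    intro x hx
    rcases List.mem_append.mp hx with hx | hx
    · exact h.memA x hx
    · simp at hx; rwa [hx]
  memW := by
    have := hr.memW H h.memW
    intro z hz
    rcases List.mem_cons.mp hz with rfl | hz
    · exact this.1
    · exact this.2 z hz
  basis := by
    obtain ⟨l, h1, h2⟩ := h.basis
    exact ⟨l, h1.trans (by simp), h2⟩
  rep := by
    intro x hx hN
    rw [← hr.rep x]
    · exact h.rep x hx (hN.mono (by simp))
    · exact h.tn _ (by simp [hv, hx]) (by simpa using hN)
  tn := by
    intro V hV hN
    have h1 := h.tn (v :: V) (by simpa [hv] using hV) (by simpa using hN)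
    exact (hr.tn [] V h1).mono (by simp) (by simp)
  dual := hr.dual h.dual

theorem St.loop {f : List E → ℝ} {H : Submodule ℝ E} {A : List E} {Z : List (E × (E →ₗ[ℝ] ℝ))}
    (h : St f H A Z) : St f H (A ++ [0]) Z where
  alt := h.alt
  memA := by
    intro x hx
    rcases List.mem_append.mp hx with hx | hx
    · exact h.memA x hx
    · simp at hx; simp [hx]
  memW := h.memW
  basis := by
    obtain ⟨l, h1, h2⟩ := h.basis
    exact ⟨l, h1.trans (by simp), h2⟩
  rep := fun x hx hN => h.rep x hx (hN.mono (by simp))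
  tn := fun V hV hN => h.tn V hV (hN.mono (by simp))
  dual := h.dual

/-- the projection used in the coloop step -/
noncomputable def qmap (h : E →ₗ[ℝ] ℝ) (e : E) : E →ₗ[ℝ] E := h.smulRight e - LinearMap.id

theorem qmap_apply (h : E →ₗ[ℝ] ℝ) (e x : E) : qmap h e x = h x • e - x := rfl

theorem G_comp (R : List (E →ₗ[ℝ] ℝ)) (V : List E) (q : E →ₗ[ℝ] E) :
    G (R.map (fun β => β ∘ₗ q)) V = G R (V.map q) := by
  by_cases hl : R.length = V.length
  · rw [G_eq (n := R.length) (by simp) hl.symm, G_eq rfl (by simp [hl])]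
    congr 1
    ext i j
    have hi := i.2
    have hj : (j : ℕ) < V.length := by rw [← hl]; exact j.2
    simp [List.getD_eq_getElem?_getD, hj]
  · have h1 : G (R.map (fun β => β ∘ₗ q)) V = 0 := by
      by_contra h; apply hl; simpa using G_length h
    have h2 : G R (V.map q) = 0 := by
      by_contra h; apply hl; simpa using G_length h
    rw [h1, h2]

noncomputable def cmap (h : E →ₗ[ℝ] ℝ) (e : E) (z : E × (E →ₗ[ℝ] ℝ)) : E × (E →ₗ[ℝ] ℝ) :=
  (-z.1, z.2 ∘ₗ qmap h e)

theorem exists_last (h : E →ₗ[ℝ] ℝ) (V : List E) : (∀ x ∈ V, h x = 0) ∨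
    ∃ V₁ x V₂, V = V₁ ++ x :: V₂ ∧ h x ≠ 0 ∧ ∀ y ∈ V₂, h y = 0 := by
  induction V with
  | nil => left; simp
  | cons x V ih =>
    rcases ih with ih | ⟨V₁, y, V₂, rfl, h1, h2⟩
    · by_cases hx : h x = 0
      · left; simpa [hx] using ih
      · right; exact ⟨[], x, V, rfl, hx, ih⟩
    · right; exact ⟨x :: V₁, y, V₂, rfl, h1, h2⟩

end Positroid


namespace Positroid

variable {E : Type} [AddCommGroup E] [Module ℝ E]

/-- the coloop data -/
structure Co (f : List E → ℝ) (H H₀ : Submodule ℝ E) (h : E →ₗ[ℝ] ℝ) (e : E) : Prop where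
  alt : IsAlt f
  van : ∀ l : List E, (∀ x ∈ l, x ∈ H₀) → f l = 0
  he : h e = 1
  h0 : ∀ x ∈ H₀, h x = 0
  le : H₀ ≤ H
  eH : e ∈ H
  q : ∀ x ∈ H, qmap h e x ∈ H₀

theorem Co.last {f : List E → ℝ} {H H₀ : Submodule ℝ E} {h : E →ₗ[ℝ] ℝ} {e : E} (c : Co f H H₀ h e)
    (l : List E) (hl : ∀ x ∈ l, x ∈ H₀) (x : E) (hx : x ∈ H) : f (l ++ [x]) = h x * f (l ++ [e]) := by
  have h1 : f (l ++ [qmap h e x]) = 0 := by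
    apply c.van
    intro y hy
    rcases List.mem_append.mp hy with hy | hy
    · exact hl y hy
    · simp at hy; rw [hy]; exact c.q x hx
  rw [qmap_apply, c.alt.sub, c.alt.smul] at h1
  linarith

theorem Co.neg_q {f : List E → ℝ} {H H₀ : Submodule ℝ E} {h : E →ₗ[ℝ] ℝ} {e : E} (c : Co f H H₀ h e)
    (l c' : List E) : f (l ++ c'.map (qmap h e) ++ [e]) = f (l ++ e :: c') := by
  rw [← c.alt.move' l c' e]
  have := c.alt.add_block l (c'.map (fun y => -y)) (fun y => -(h y)) e [e] (by simp)
  rw [← this, List.map_map]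
  congr 3
  apply List.map_congr_left
  intro x _
  simp [qmap_apply]; abel

theorem Co.nn_q {f : List E → ℝ} {H H₀ : Submodule ℝ E} {h : E →ₗ[ℝ] ℝ} {e : E} (c : Co f H H₀ h e)
    {A V : List E} (hN : NN f (A ++ [e] ++ V)) : NN (fun l => f (l ++ [e])) (A ++ V.map (qmap h e)) := by
  intro l hl
  obtain ⟨l₁, l₂, rfl, h1, h2⟩ := List.sublist_append_iff.mp hl
  obtain ⟨l₃, h3, rfl⟩ := List.sublist_map_iff.mp h2
  show 0 ≤ f (l₁ ++ l₃.map (qmap h e) ++ [e])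
  rw [c.neg_q]
  apply hN
  have : (l₁ ++ ([e] ++ l₃)).Sublist (A ++ ([e] ++ V)) := h1.append (h3.append_left _)
  simpa using this

theorem Co.tn_head {f : List E → ℝ} {H H₀ : Submodule ℝ E} {h : E →ₗ[ℝ] ℝ} {e : E} (c : Co f H H₀ h e)
    {A : List E} {Z : List (E × (E →ₗ[ℝ] ℝ))} (hS : St (fun l => f (l ++ [e])) H₀ A Z)
    {r : List (E →ₗ[ℝ] ℝ)} (hr : r.Sublist (bs Z))
    {V : List E} (hV : ∀ x ∈ V, x ∈ H) (hN : NN f (A ++ [e] ++ V)) :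
    0 ≤ G (h :: r.map (fun β => β ∘ₗ qmap h e)) V := by
  rcases exists_last h V with h0 | ⟨V₁, x, V₂, rfl, hx, h2⟩
  · apply le_of_eq
    cases V with
    | nil => simp [G]
    | cons x V => rw [G_row _ _ _ _ (fun y hy => h0 y (by simp [hy])), h0 x (by simp), zero_mul]
  have hxH : x ∈ H := hV x (by simp)
  have hx0 : 0 < h x := by
    obtain ⟨l, hl, hp⟩ := hS.basis
    have h1 := c.last l (fun y hy => hS.memA y (hl.subset hy)) x hxH
    have h3 : 0 ≤ f (l ++ [x]) := by
      apply hN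
      refine (hl.append_right [x]).trans ?_
      simp only [List.append_assoc]
      exact List.Sublist.append_left (by simp) _
    rw [h1] at h3
    have : 0 ≤ h x := by
      by_contra hn
      push Not at hn
      have hp' : 0 < f (l ++ [e]) := hp
      nlinarith
    exact lt_of_le_of_ne this (Ne.symm hx)
  set X : E → E := fun y => y + (-(h y / h x)) • x with hX
  have hXh : ∀ y, h (X y) = 0 := by intro y; simp [hX]; field_simp; ring
  have hXneg : ∀ y, X (-y) = - X y := by intro y; simp [hX, neg_div]; abel
  have hXH : ∀ y ∈ H, X y ∈ H₀ := by
    intro y hy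
    have h4 : X y ∈ H := H.add_mem hy (H.smul_mem _ hxH)
    have := c.q _ h4
    rw [qmap_apply, hXh, zero_smul, zero_sub] at this
    simpa using this
  have hqz : ∀ y, h y = 0 → qmap h e y = -y := by intro y hy; simp [qmap_apply, hy]
  set R' := r.map (fun β => β ∘ₗ qmap h e) with hR'
  have alt := G_isAlt (h :: R')
  have m1 := alt.move [] V₁ x V₂
  simp only [List.nil_append] at m1
  have m2 := alt.add_block [x] (V₁.map (fun y => -y)) (fun y => -(h y / h x)) x V₂ (by simp)
  simp only [List.cons_append, List.nil_append] at m2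
  rw [m1, ← m2, G_row, hR', G_comp]
  · apply mul_nonneg hx0.le
    set U := V₁.map X ++ V₂.map (fun y => -y) with hU
    have hUe : (List.map (fun y => y + -(h y / h x) • x) (List.map (fun y => -y) V₁) ++ V₂).map (qmap h e) = U := by
      rw [List.map_append, hU, List.map_map, List.map_map]
      congr 1
      · apply List.map_congr_left
        intro y _
        show qmap h e (X (-y)) = X y
        rw [hqz _ (hXh _), hXneg, neg_neg]
      · apply List.map_congr_left
        intro y hy
        exact hqz y (h2 y hy)
    rw [hUe]
    have hUH : ∀ u ∈ U, u ∈ H₀ := by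
      intro u hu
      rcases List.mem_append.mp hu with hu | hu
      · obtain ⟨y, hy, rfl⟩ := List.mem_map.mp hu
        exact hXH y (hV y (by simp [hy]))
      · obtain ⟨y, hy, rfl⟩ := List.mem_map.mp hu
        rw [← hqz y (h2 y hy)]
        exact c.q y (hV y (by simp [hy]))
    refine hS.tn U hUH ?_ r hr U (List.Sublist.refl _)
    intro l hl
    have hlH : ∀ u ∈ l, u ∈ H₀ := by
      intro u hu
      rcases List.mem_append.mp (hl.subset hu) with hu | hu
      · exact hS.memA u hu
      · exact hUH u hu
    obtain ⟨l₁, l₂, rfl, h3, h4⟩ := List.sublist_append_iff.mp hl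
    obtain ⟨l₃, l₄, rfl, h5, h6⟩ := List.sublist_append_iff.mp h4
    obtain ⟨T₁, h7, rfl⟩ := List.sublist_map_iff.mp h5
    obtain ⟨T₂, h8, rfl⟩ := List.sublist_map_iff.mp h6
    have k1 := c.last _ hlH x hxH
    have k2 := c.alt.add_block l₁ T₁ (fun y => -(h y / h x)) x (T₂.map (fun y => -y) ++ [x]) (by simp)
    have k3 := c.alt.move' (l₁ ++ T₁) T₂ x
    have k4 : 0 ≤ f (l₁ ++ T₁ ++ x :: T₂) := by
      apply hN
      have : (l₁ ++ (T₁ ++ x :: T₂)).Sublist ((A ++ [e]) ++ (V₁ ++ x :: V₂)) :=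
        (h3.trans (by simp)).append (h7.append (h8.cons_cons x))
      simpa using this
    have k5 : f (l₁ ++ (T₁.map X ++ T₂.map (fun y => -y)) ++ [x]) = f (l₁ ++ T₁ ++ x :: T₂) := by
      rw [← k3]
      simp only [List.append_assoc] at k2 ⊢
      exact k2
    rw [k5] at k1
    rw [k1] at k4
    show 0 ≤ f (l₁ ++ (T₁.map X ++ T₂.map (fun y => -y)) ++ [e])
    by_contra hn
    push Not at hn
    nlinarith
  · intro y hy
    rcases List.mem_append.mp hy with hy | hy
    · obtain ⟨z, _, rfl⟩ := List.mem_map.mp hy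
      exact hXh z
    · exact h2 y hy

theorem cmap_sum (h : E →ₗ[ℝ] ℝ) (e x : E) (Z : List (E × (E →ₗ[ℝ] ℝ))) :
    (List.map ((fun z => z.2 x • z.1) ∘ cmap h e) Z).sum
        = - (List.map (fun z => z.2 (qmap h e x) • z.1) Z).sum := by
  induction Z with
  | nil => simp
  | cons z Z ih =>
    rw [List.map_cons, List.sum_cons, ih, List.map_cons, List.sum_cons]
    simp [cmap]; abel

theorem St.coloop {f : List E → ℝ} {H H₀ : Submodule ℝ E} {h : E →ₗ[ℝ] ℝ} {e : E} {A : List E}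
    {Z : List (E × (E →ₗ[ℝ] ℝ))} (hS : St (fun l => f (l ++ [e])) H₀ A Z) (c : Co f H H₀ h e) :
    St f H (A ++ [e]) ((e, h) :: Z.map (cmap h e)) where
  alt := c.alt
  memA := by
    intro x hx
    rcases List.mem_append.mp hx with hx | hx
    · exact c.le (hS.memA x hx)
    · simp at hx; rw [hx]; exact c.eH
  memW := by
    intro z hz
    rcases List.mem_cons.mp hz with rfl | hz
    · exact c.eH
    · obtain ⟨z', hz', rfl⟩ := List.mem_map.mp hz
      exact c.le (H₀.neg_mem (hS.memW z' hz'))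
  basis := by
    obtain ⟨l, h1, h2⟩ := hS.basis
    exact ⟨l ++ [e], h1.append_right _, h2⟩
  rep := by
    intro x hx hN
    have h1 := hS.rep _ (c.q x hx) (c.nn_q (V := [x]) hN)
    simp only [List.map_cons, List.sum_cons, List.map_map]
    have h2 : (List.map ((fun z => z.2 x • z.1) ∘ cmap h e) Z).sum
        = - (List.map (fun z => z.2 (qmap h e x) • z.1) Z).sum := by
      exact cmap_sum h e x Z
    rw [h2, ← h1, qmap_apply]; abel
  tn := by
    intro V hV hN r hr V' hV'
    have hN' : NN f (A ++ [e] ++ V') := hN.mono (hV'.append_left _)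
    have hVH : ∀ x ∈ V', x ∈ H := fun x hx => hV x (hV'.subset hx)
    have hb : bs ((e, h) :: Z.map (cmap h e)) = h :: (bs Z).map (fun β => β ∘ₗ qmap h e) := by
      simp [bs, cmap, Function.comp_def]
    rw [hb] at hr
    rcases List.sublist_cons_iff.mp hr with hr | ⟨r', rfl, hr'⟩
    · obtain ⟨r', h1, rfl⟩ := List.sublist_map_iff.mp hr
      rw [G_comp]
      refine hS.tn _ ?_ (c.nn_q hN') _ h1 _ (List.Sublist.refl _)
      intro x hx
      obtain ⟨y, hy, rfl⟩ := List.mem_map.mp hx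
      exact c.q y (hVH y hy)
    · obtain ⟨r, h1, rfl⟩ := List.sublist_map_iff.mp hr'
      exact c.tn_head hS h1 hVH hN'
  dual := by
    have hqe : qmap h e e = 0 := by simp [qmap_apply, c.he]
    have hqz : ∀ y ∈ H₀, qmap h e y = -y := by intro y hy; simp [qmap_apply, c.h0 y hy]
    constructor
    · rw [List.pairwise_cons]
      constructor
      · intro z hz
        obtain ⟨z', hz', rfl⟩ := List.mem_map.mp hz
        simp [cmap, hqe, c.h0 _ (hS.memW _ hz')]
      · rw [List.pairwise_map]
        refine hS.dual.1.imp_of_mem ?_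
        intro a b ha hb hab
        simp [cmap, hqz _ (hS.memW _ ha), hqz _ (hS.memW _ hb), hab]
    · intro z hz
      rcases List.mem_cons.mp hz with rfl | hz
      · exact c.he
      · obtain ⟨z', hz', rfl⟩ := List.mem_map.mp hz
        simp [cmap, hqz _ (hS.memW _ hz'), hS.dual.2 _ hz']

theorem St.nil {f : List E → ℝ} {H : Submodule ℝ E} (hf : IsAlt f) (h0 : 0 < f []) (hH : ∀ x ∈ H, x = 0) :
    St f H [] [] where
  alt := hf
  memA := by simp
  memW := by simp
  basis := ⟨[], by simp, h0⟩
  rep := by intro v hv _; simp [hH v hv]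
  tn := by
    intro V _ _ r hr c _
    have : r = [] := by simpa [bs] using hr
    subst this
    cases c with
    | nil => simp [G_nil]
    | cons x c => simp [G]
  dual := ⟨by simp, by simp⟩

/-- combinatorial types: `none` = coloop, `some none` = loop, `some (some s)` = generic -/
inductive Typ : List (Option (Option (List Bool))) → (List E → ℝ) → Submodule ℝ E → List E →
    List (E × (E →ₗ[ℝ] ℝ)) → Prop
  | nil (f : List E → ℝ) (H : Submodule ℝ E) : IsAlt f → 0 < f [] → (∀ x ∈ H, x = 0) → Typ [] f H [] []
  | coloop (τ) (f : List E → ℝ) (H H₀ : Submodule ℝ E) (h : E →ₗ[ℝ] ℝ) (e : E) (A) (Z) :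
      Typ τ (fun l => f (l ++ [e])) H₀ A Z → Co f H H₀ h e →
      Typ (none :: τ) f H (A ++ [e]) ((e, h) :: Z.map (cmap h e))
  | loop (τ) (f : List E → ℝ) (H : Submodule ℝ E) (A) (Z) : Typ τ f H A Z →
      Typ (some none :: τ) f H (A ++ [0]) Z
  | pos (τ) (f : List E → ℝ) (H : Submodule ℝ E) (A) (Z) (v s y l) : Typ τ f H A Z →
      RedP v Z s y l → v ∈ H → y.1 = v → Typ (some (some s) :: τ) f H (A ++ [v]) (y :: l)

theorem Typ.st {τ} {f : List E → ℝ} {H : Submodule ℝ E} {A : List E} {Z : List (E × (E →ₗ[ℝ] ℝ))}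
    (h : Typ τ f H A Z) : St f H A Z := by
  induction h with
  | nil f H h1 h2 h3 => exact St.nil h1 h2 h3
  | coloop τ f H H₀ h e A Z _ hc ih => exact ih.coloop hc
  | loop τ f H A Z _ ih => exact ih.loop
  | pos τ f H A Z v s y l _ hr hv hy ih => exact ih.pos hr hv hy

end Positroid


namespace Positroid

variable {E F : Type} [AddCommGroup E] [Module ℝ E] [AddCommGroup F] [Module ℝ F]

/-- simultaneous nonnegativity with the same supports -/
def Rel (f : List E → ℝ) (g : List F → ℝ) (L : List (E × F)) : Prop :=
  ∀ l : List (E × F), l.Sublist L → 0 ≤ f (l.map Prod.fst) ∧ 0 ≤ g (l.map Prod.snd) ∧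
    (0 < f (l.map Prod.fst) ↔ 0 < g (l.map Prod.snd))

namespace Rel

variable {f : List E → ℝ} {g : List F → ℝ}

theorem mono {L L' : List (E × F)} (h : Rel f g L') (hL : L.Sublist L') : Rel f g L :=
  fun l hl => h l (hl.trans hL)

theorem scale (hf : IsAlt f) (hg : IsAlt g) {pre post : List (E × F)} {x : E × F} {a b : ℝ}
    (ha : 0 < a) (hb : 0 < b) (h : Rel f g (pre ++ x :: post)) :
    Rel f g (pre ++ (a • x.1, b • x.2) :: post) := by
  intro l hl
  obtain ⟨l₁, l₂, rfl, h1, h2⟩ := List.sublist_append_iff.mp hl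
  rcases List.sublist_cons_iff.mp h2 with h3 | ⟨l₃, rfl, h3⟩
  · exact h _ (h1.append (h3.trans (by simp)))
  · have := h (l₁ ++ x :: l₃) (h1.append (h3.cons_cons x))
    simp only [List.map_append, List.map_cons] at this ⊢
    rw [hf.smul, hg.smul]
    refine ⟨mul_nonneg ha.le this.1, mul_nonneg hb.le this.2.1, ?_⟩
    rw [mul_pos_iff_of_pos_left ha, mul_pos_iff_of_pos_left hb]
    exact this.2.2

theorem addAdj (hf : IsAlt f) (hg : IsAlt g) {pre post : List (E × F)} {x y : E × F}
    (h : Rel f g (pre ++ x :: y :: post)) :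
    Rel f g (pre ++ (x.1 + y.1, x.2 + y.2) :: y :: post) := by
  intro l hl
  obtain ⟨l₁, l₂, rfl, h1, h2⟩ := List.sublist_append_iff.mp hl
  rcases List.sublist_cons_iff.mp h2 with h3 | ⟨l₃, rfl, h3⟩
  · exact h _ (h1.append (h3.trans (by simp)))
  · rcases List.sublist_cons_iff.mp h3 with h4 | ⟨l₄, rfl, h4⟩
    · have k1 := h (l₁ ++ x :: l₃) (h1.append ((h4.trans (by simp)).cons_cons x))
      have k2 := h (l₁ ++ y :: l₃) (h1.append ((h4.cons_cons y).trans (by simp)))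
      simp only [List.map_append, List.map_cons] at k1 k2 ⊢
      rw [hf.add, hg.add]
      refine ⟨add_nonneg k1.1 k2.1, add_nonneg k1.2.1 k2.2.1, ?_⟩
      obtain ⟨a1, a2, a3⟩ := k1
      obtain ⟨b1, b2, b3⟩ := k2
      constructor
      · intro hp
        rcases a1.eq_or_lt with a1 | a1
        · have := b3.mp (by linarith); linarith
        · have := a3.mp a1; linarith
      · intro hp
        rcases a2.eq_or_lt with a2 | a2
        · have := b3.mpr (by linarith); linarith
        · have := a3.mpr a2; linarith
    · have := h (l₁ ++ x :: y :: l₄) (h1.append ((h4.cons_cons y).cons_cons x))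
      simp only [List.map_append, List.map_cons] at this ⊢
      have e1 := hf.add_mem (l₁ := l₁.map Prod.fst) (l₂ := y.1 :: l₄.map Prod.fst) (x := y.1) (y := x.1) 1 (by simp)
      have e2 := hg.add_mem (l₁ := l₁.map Prod.snd) (l₂ := y.2 :: l₄.map Prod.snd) (x := y.2) (y := x.2) 1 (by simp)
      rw [one_smul] at e1 e2
      rw [e1, e2]
      exact this

theorem dup (hf : IsAlt f) (hg : IsAlt g) {pre post : List (E × F)} {x : E × F}
    (h : Rel f g (pre ++ x :: post)) : Rel f g (pre ++ x :: x :: post) := by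
  intro l hl
  obtain ⟨l₁, l₂, rfl, h1, h2⟩ := List.sublist_append_iff.mp hl
  rcases List.sublist_cons_iff.mp h2 with h3 | ⟨l₃, rfl, h3⟩
  · exact h _ (h1.append h3)
  · rcases List.sublist_cons_iff.mp h3 with h4 | ⟨l₄, rfl, h4⟩
    · exact h _ (h1.append (h4.cons_cons x))
    · simp [hf.alt, hg.alt]

theorem zero (hf : IsAlt f) (hg : IsAlt g) {pre post : List (E × F)}
    (h : Rel f g (pre ++ post)) : Rel f g (pre ++ (0, 0) :: post) := by
  intro l hl
  obtain ⟨l₁, l₂, rfl, h1, h2⟩ := List.sublist_append_iff.mp hl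
  rcases List.sublist_cons_iff.mp h2 with h3 | ⟨l₃, rfl, h3⟩
  · exact h _ (h1.append h3)
  · simp [hf.zero, hg.zero]

theorem coloop {H H₀ : Submodule ℝ E} {K K₀ : Submodule ℝ F} {h k e e'} (c : Co f H H₀ h e)
    (c' : Co g K K₀ k e') {P Q : List (E × F)} (hP : ∀ x ∈ P ++ Q, x.1 ∈ H₀ ∧ x.2 ∈ K₀)
    (hR : Rel (fun l => f (l ++ [e])) (fun l => g (l ++ [e'])) (P ++ Q)) :
    Rel f g (P ++ (e, e') :: Q.map (fun y => -y)) := by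
  intro l hl
  obtain ⟨l₁, l₂, rfl, h1, h2⟩ := List.sublist_append_iff.mp hl
  rcases List.sublist_cons_iff.mp h2 with h3 | ⟨l₃, rfl, h3⟩
  · obtain ⟨l₄, h4, rfl⟩ := List.sublist_map_iff.mp h3
    have k1 : f ((l₁ ++ l₄.map (fun y => -y)).map Prod.fst) = 0 := by
      apply c.van
      intro x hx
      obtain ⟨z, hz, rfl⟩ := List.mem_map.mp hx
      rcases List.mem_append.mp hz with hz | hz
      · exact (hP z (by simp [h1.subset hz])).1
      · obtain ⟨z', hz', rfl⟩ := List.mem_map.mp hz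
        exact H₀.neg_mem (hP z' (by simp [h4.subset hz'])).1
    have k2 : g ((l₁ ++ l₄.map (fun y => -y)).map Prod.snd) = 0 := by
      apply c'.van
      intro x hx
      obtain ⟨z, hz, rfl⟩ := List.mem_map.mp hx
      rcases List.mem_append.mp hz with hz | hz
      · exact (hP z (by simp [h1.subset hz])).2
      · obtain ⟨z', hz', rfl⟩ := List.mem_map.mp hz
        exact K₀.neg_mem (hP z' (by simp [h4.subset hz'])).2
    rw [k1, k2]; simp
  · obtain ⟨l₄, h4, rfl⟩ := List.sublist_map_iff.mp h3
    have := hR (l₁ ++ l₄) (h1.append h4)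
    have k1 := c.alt.move' (l₁.map Prod.fst) ((l₄.map (fun y => -y)).map Prod.fst) e
    have k2 := c'.alt.move' (l₁.map Prod.snd) ((l₄.map (fun y => -y)).map Prod.snd) e'
    simp only [List.map_map, Function.comp_def, Prod.fst_neg, Prod.snd_neg, neg_neg] at k1 k2
    simp only [List.map_append] at this
    simp only [List.map_append, List.map_cons, List.map_map, Function.comp_def, Prod.fst_neg, Prod.snd_neg]
    rw [← k1, ← k2]
    exact this

end Rel

theorem RedP.rel {f : List E → ℝ} {g : List F → ℝ} (hf : IsAlt f) (hg : IsAlt g) {v : E} {Z s y l}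
    (h : RedP v Z s y l) {v' : F} : ∀ {Z' y' l'}, RedP v' Z' s y' l' → ∀ Q : List (E × F), 
    Q.map Prod.fst = ws Z → Q.map Prod.snd = ws Z' →
    ∃ Q' : List (E × F), Q'.map Prod.fst = ws l ∧ Q'.map Prod.snd = ws l' ∧
      ∀ pre, Rel f g (pre ++ Q) → Rel f g (pre ++ (y.1, y'.1) :: Q') := by
  induction h with
  | start w β l hp h0 =>
    intro Z' y' l' h' Q h1 h2
    cases h' with
    | start w' β' l' hp' h0' =>
      cases Q with
      | nil => simp at h1
      | cons x Q =>
        simp only [List.map_cons, List.cons.injEq] at h1 h2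
        obtain ⟨rfl, h1⟩ := h1
        obtain ⟨rfl, h2⟩ := h2
        exact ⟨Q, h1, h2, fun pre hR => hR.scale hf hg hp hp'⟩
  | skip z l s y l' h h0 ih =>
    intro Z' y' l' h' Q h1 h2
    cases h' with
    | skip z' l' _ _ _ h' h0' =>
      cases Q with
      | nil => simp at h1
      | cons x Q =>
        simp only [List.map_cons, List.cons.injEq] at h1 h2
        obtain ⟨Q', k1, k2, k3⟩ := ih h' Q h1.2 h2.2
        exact ⟨Q', k1, k2, fun pre hR => k3 pre (hR.mono (by simp))⟩
  | add w β l s y l' h hp ih =>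
    intro Z' y' l' h' Q h1 h2
    cases h' with
    | add w' β' l' _ y' l'' h' hp' =>
      cases Q with
      | nil => simp at h1
      | cons x Q =>
        simp only [List.map_cons, List.cons.injEq] at h1 h2
        obtain ⟨rfl, h1⟩ := h1
        obtain ⟨rfl, h2⟩ := h2
        obtain ⟨Q', k1, k2, k3⟩ := ih h' Q h1 h2
        refine ⟨(y.1, y'.1) :: Q', by simp [k1], by simp [k2], fun pre hR => ?_⟩
        have r1 := hR.scale hf hg hp hp'
        have r2 := k3 (pre ++ [(β v • x.1, β' v' • x.2)]) (by simpa using r1)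
        have r3 := Rel.addAdj hf hg (pre := pre) (post := Q') (x := (β v • x.1, β' v' • x.2)) (y := (y.1, y'.1)) (by simpa using r2)
        exact r3

theorem Typ.rel {τ} {f : List E → ℝ} {H : Submodule ℝ E} {A : List E} {Z : List (E × (E →ₗ[ℝ] ℝ))}
    (h : Typ τ f H A Z) : ∀ {g : List F → ℝ} {K : Submodule ℝ F} {B : List F} {Z' : List (F × (F →ₗ[ℝ] ℝ))},
    Typ τ g K B Z' → ∃ P Q : List (E × F), P.map Prod.fst = A ∧ P.map Prod.snd = B ∧
      Q.map Prod.fst = ws Z ∧ Q.map Prod.snd = ws Z' ∧ Rel f g (P ++ Q) := by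
  induction h with
  | nil f H h1 h2 h3 =>
    intro g K B Z' h'
    cases h' with
    | nil _ _ k1 k2 k3 =>
      refine ⟨[], [], rfl, rfl, rfl, rfl, ?_⟩
      intro l hl
      have : l = [] := by simpa using hl
      subst this
      simp [h2, k2, h2.le, k2.le]
  | coloop τ f H H₀ h e A Z hT hc ih =>
    intro g K B Z' h'
    cases h' with
    | coloop _ _ _ K₀ k e' B Z' hT' hc' =>
      obtain ⟨P, Q, rfl, rfl, h3, h4, h5⟩ := ih hT'
      have hs := hT.st
      have hs' := hT'.st
      have := h5.coloop hc hc' (by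
        intro x hx
        rcases List.mem_append.mp hx with hx | hx
        · exact ⟨hs.memA _ (List.mem_map_of_mem hx), hs'.memA _ (List.mem_map_of_mem hx)⟩
        · constructor
          · have : x.1 ∈ ws Z := by rw [← h3]; exact List.mem_map_of_mem hx
            obtain ⟨z, hz, hz'⟩ := List.mem_map.mp this
            rw [← hz']; exact hs.memW z hz
          · have : x.2 ∈ ws Z' := by rw [← h4]; exact List.mem_map_of_mem hx
            obtain ⟨z, hz, hz'⟩ := List.mem_map.mp this
            rw [← hz']; exact hs'.memW z hz)
      refine ⟨P ++ [(e, e')], (e, e') :: Q.map (fun y => -y), by simp, by simp, ?_, ?_, ?_⟩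
      · have : (Q.map Prod.fst).map (fun y => -y) = (ws Z).map (fun y => -y) := by rw [h3]
        simpa [cmap, Function.comp_def] using this
      · have : (Q.map Prod.snd).map (fun y => -y) = (ws Z').map (fun y => -y) := by rw [h4]
        simpa [cmap, Function.comp_def] using this
      · simpa using this.dup hc.alt hc'.alt
  | loop τ f H A Z hT ih =>
    intro g K B Z' h'
    cases h' with
    | loop _ _ _ B Z' hT' =>
      obtain ⟨P, Q, rfl, rfl, h3, h4, h5⟩ := ih hT'
      refine ⟨P ++ [(0, 0)], Q, by simp, by simp, h3, h4, ?_⟩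
      simpa using h5.zero hT.st.alt hT'.st.alt
  | pos τ f H A Z v s y l hT hr hv hy ih =>
    intro g K B Z' h'
    cases h' with
    | pos _ _ _ B Z' v' _ y' l' hT' hr' hv' hy' =>
      obtain ⟨P, Q, rfl, rfl, h3, h4, h5⟩ := ih hT'
      obtain ⟨Q', k1, k2, k3⟩ := hr.rel hT.st.alt hT'.st.alt hr' Q h3 h4
      have := k3 _ h5
      refine ⟨P ++ [(v, v')], (v, v') :: Q', by simp, by simp, by simp [k1, hy], by simp [k2, hy'], ?_⟩
      rw [hy, hy'] at this
      simpa using this.dup hT.st.alt hT'.st.alt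

end Positroid


namespace Positroid

variable {E F : Type} [AddCommGroup E] [Module ℝ E] [AddCommGroup F] [Module ℝ F]

theorem exists_typ (A : List E) : ∀ (f : List E → ℝ) (H : Submodule ℝ E), IsAlt f → NN f A →
    (∀ x ∈ A, x ∈ H) → (∃ l : List E, l.Sublist A ∧ f l ≠ 0) →
    (∀ l : List E, (∀ x ∈ l, x ∈ H) → f l ≠ 0 → H ≤ Submodule.span ℝ {y | y ∈ l}) →
    ∃ τ Z, Typ τ f H A Z := by
  induction A using List.reverseRecOn with
  | nil =>
    intro f H hf hN _ ⟨l, hl, h0⟩ h9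
    have : l = [] := by simpa using hl
    subst this
    refine ⟨[], [], .nil f H hf (lt_of_le_of_ne (hN [] (by simp)) (Ne.symm h0)) ?_⟩
    intro x hx
    have := h9 [] (by simp) h0 hx
    simpa using this
  | append_singleton A e ih =>
    intro f H hf hN hA hb h9
    have heH : e ∈ H := hA e (by simp)
    have hAH : ∀ x ∈ A, x ∈ H := fun x hx => hA x (by simp [hx])
    by_cases hb0 : ∃ l : List E, l.Sublist A ∧ f l ≠ 0
    · obtain ⟨τ, Z, hT⟩ := ih f H hf (hN.mono (by simp)) hAH hb0 h9
      have h1 := hT.st.rep e heH hN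
      have h2 := hT.st.tn [e] (by simp [heH]) hN
      rcases RedP.exists_of e Z (fun z hz => h2.nonneg (List.mem_map_of_mem hz) (by simp)) with h0 | ⟨s, y, l, hr⟩
      · have : e = 0 := by
          rw [h1]
          apply List.sum_eq_zero
          intro x hx
          obtain ⟨z, hz, rfl⟩ := List.mem_map.mp hx
          simp [h0 z hz]
        subst this
        exact ⟨_, _, .loop τ f H A Z hT⟩
      · exact ⟨_, _, .pos τ f H A Z e s y l hT hr heH (by rw [hr.sum, ← h1])⟩
    · push Not at hb0
      obtain ⟨l, hl, hl0⟩ := hb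
      obtain ⟨l₁, hl₁, hl₁0⟩ : ∃ l₁ : List E, l₁.Sublist A ∧ f (l₁ ++ [e]) ≠ 0 := by
        obtain ⟨l₁, l₂, rfl, k1, k2⟩ := List.sublist_append_iff.mp hl
        rcases List.sublist_cons_iff.mp k2 with k3 | ⟨l₃, rfl, k3⟩
        · have : l₂ = [] := by simpa using k3
          subst this
          rw [List.append_nil] at hl0
          exact absurd (hb0 _ k1) hl0
        · have : l₃ = [] := by simpa using k3
          subst this
          exact ⟨l₁, k1, hl0⟩
      set H₀ := Submodule.span ℝ {y | y ∈ A} with hH₀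
      have hvan : ∀ l : List E, (∀ x ∈ l, x ∈ H₀) → f l = 0 := fun l hl => hf.span_zero hb0 l hl
      have hAs : ∀ x ∈ A, x ∈ H₀ := fun x hx => Submodule.subset_span hx
      have heN : e ∉ H₀ := by
        intro he
        apply hl₁0
        apply hvan
        intro x hx
        rcases List.mem_append.mp hx with hx | hx
        · exact hAs x (hl₁.subset hx)
        · simp at hx; rwa [hx]
      obtain ⟨h', hh', hk'⟩ := Submodule.exists_le_ker_of_notMem heN
      obtain ⟨h, he, hk⟩ : ∃ h : E →ₗ[ℝ] ℝ, h e = 1 ∧ ∀ x ∈ H₀, h x = 0 := by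
        refine ⟨(h' e)⁻¹ • h', by simp [hh'], ?_⟩
        intro x hx
        have : h' x = 0 := hk' hx
        simp [this]
      have hle : H₀ ≤ H := by
        rw [hH₀, Submodule.span_le]; exact hAH
      have hdec : ∀ l : List E, (∀ x ∈ l, x ∈ H₀) → f (l ++ [e]) ≠ 0 → ∀ x ∈ H,
          ∃ c : ℝ, ∃ y ∈ Submodule.span ℝ {y | y ∈ l}, x = c • e + y := by
        intro l hl h0 x hx
        have h1 : ∀ x ∈ l ++ [e], x ∈ H := by
          intro x hx
          rcases List.mem_append.mp hx with hx | hx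
          · exact hle (hl x hx)
          · simp at hx; rwa [hx]
        have h2 := h9 _ h1 h0 hx
        have h3 : {y | y ∈ l ++ [e]} = insert e {y | y ∈ l} := by ext z; simp; tauto
        rw [h3, Submodule.mem_span_insert] at h2
        exact h2
      have hspan : ∀ l : List E, (∀ x ∈ l, x ∈ H₀) → Submodule.span ℝ {y | y ∈ l} ≤ H₀ := by
        intro l hl; rw [Submodule.span_le]; exact hl
      have hl₁H : ∀ x ∈ l₁, x ∈ H₀ := fun x hx => hAs x (hl₁.subset hx)
      have co : Co f H H₀ h e := by
        refine ⟨hf, hvan, he, hk, hle, heH, ?_⟩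
        intro x hx
        obtain ⟨c, y, hy, rfl⟩ := hdec l₁ hl₁H hl₁0 x hx
        have hy0 := hspan _ hl₁H hy
        rw [qmap_apply, map_add, map_smul, he, hk y hy0]
        simpa using hy0
      obtain ⟨τ, Z, hT⟩ := ih (fun l => f (l ++ [e])) H₀ (hf.contract e)
        (fun l hl => hN _ (hl.append_right _)) hAs ⟨l₁, hl₁, hl₁0⟩ (by
          intro l hl h0 x hx
          obtain ⟨c, y, hy, hxy⟩ := hdec l hl h0 x (hle hx)
          have hy0 := hspan _ hl hy
          have hc : c = 0 := by
            have := hk x hx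
            rw [hxy, map_add, map_smul, he, hk y hy0] at this
            simpa using this
          rw [hxy, hc]; simpa using hy)
      exact ⟨_, _, .coloop τ f H H₀ h e A Z hT co⟩

theorem Typ.nnW {τ} {f : List E → ℝ} {H : Submodule ℝ E} {A : List E} {Z : List (E × (E →ₗ[ℝ] ℝ))}
    (h : Typ τ f H A Z) : NN f (A ++ ws Z) := by
  obtain ⟨P, Q, h1, _, h3, _, h5⟩ := h.rel h
  rw [← h1, ← h3, ← List.map_append]
  intro l hl
  obtain ⟨l', h6, rfl⟩ := List.sublist_map_iff.mp hl
  exact (h5 l' h6).1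

theorem exists_eps (L : List (ℝ × ℝ)) (h : ∀ p ∈ L, 0 ≤ p.1 ∧ 0 ≤ p.2 ∧ (0 < p.1 → 0 < p.2)) :
    ∃ ε : ℝ, 0 < ε ∧ ∀ p ∈ L, ε * p.1 ≤ p.2 := by
  induction L with
  | nil => exact ⟨1, one_pos, by simp⟩
  | cons p L ih =>
    obtain ⟨ε, h0, h1⟩ := ih (fun p hp => h p (by simp [hp]))
    obtain ⟨k1, k2, k3⟩ := h p (by simp)
    rcases k1.eq_or_lt with k1 | k1
    · refine ⟨ε, h0, ?_⟩
      intro q hq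
      rcases List.mem_cons.mp hq with rfl | hq
      · rw [← k1]; simpa using k2
      · exact h1 q hq
    · refine ⟨min ε (p.2 / p.1), lt_min h0 (div_pos (k3 k1) k1), ?_⟩
      intro q hq
      rcases List.mem_cons.mp hq with rfl | hq
      · calc _ ≤ q.2 / q.1 * q.1 := by gcongr; exact min_le_right _ _
          _ = q.2 := by field_simp
      · have := (h q (by simp [hq])).1
        calc _ ≤ ε * q.1 := by gcongr; exact min_le_left _ _
          _ ≤ _ := h1 q hq

theorem Typ.facet {τ} {f : List E → ℝ} {H : Submodule ℝ E} {A : List E} {Z₁ Z₂ : List (E × (E →ₗ[ℝ] ℝ))}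
    {z : E × (E →ₗ[ℝ] ℝ)}
    (h : Typ τ f H A (Z₁ ++ z :: Z₂)) : ∃ I : List E, I.Sublist A ∧ 0 < f (I ++ [z.1]) ∧
      ∀ z' ∈ Z₁ ++ Z₂, f (I ++ [z'.1]) = 0 := by
  by_contra hcon
  push Not at hcon
  have hs := h.st
  have hN := h.nnW
  have hone : ∀ I : List E, I.Sublist A → ∀ z' ∈ Z₁ ++ z :: Z₂, 0 ≤ f (I ++ [z'.1]) := by
    intro I hI z' hz'
    apply hN
    exact hI.append (List.singleton_sublist.mpr (List.mem_map_of_mem hz'))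
  set S := ((Z₁ ++ Z₂).map Prod.fst).sum with hS
  have hfS : ∀ I : List E, f (I ++ [S]) = ((Z₁ ++ Z₂).map (fun z' => f (I ++ [z'.1]))).sum := by
    intro I
    have := map_list_sum (hs.alt.toLin I []) ((Z₁ ++ Z₂).map Prod.fst)
    rw [← hS, List.map_map] at this
    exact this
  have hsub : ∀ z' ∈ Z₁ ++ Z₂, z' ∈ Z₁ ++ z :: Z₂ := by intro z'; simp; tauto
  obtain ⟨ε, hε, h1⟩ := exists_eps (A.sublists.map (fun I => (f (I ++ [z.1]), f (I ++ [S])))) (by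
    intro p hp
    obtain ⟨I, hI, rfl⟩ := List.mem_map.mp hp
    rw [List.mem_sublists] at hI
    have hnn : ∀ x ∈ (Z₁ ++ Z₂).map (fun z' => f (I ++ [z'.1])), 0 ≤ x := by
      intro x hx
      obtain ⟨z', hz', rfl⟩ := List.mem_map.mp hx
      exact hone I hI z' (hsub z' hz')
    refine ⟨hone I hI z (by simp), ?_, ?_⟩
    · simp only [hfS]
      exact List.sum_nonneg hnn
    · intro hp
      simp only at hp
      obtain ⟨z', hz', hne⟩ := hcon I hI hp
      simp only [hfS]
      refine lt_of_lt_of_le (lt_of_le_of_ne (hone I hI z' (hsub z' hz')) (Ne.symm hne)) ?_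
      exact List.single_le_sum hnn _ (List.mem_map_of_mem hz'))
  set x := S - ε • z.1 with hx
  have hSH : S ∈ H := by
    rw [hS]
    apply list_sum_mem
    intro w hw
    obtain ⟨z', hz', rfl⟩ := List.mem_map.mp hw
    exact hs.memW z' (hsub z' hz')
  have hxH : x ∈ H := H.sub_mem hSH (H.smul_mem _ (hs.memW z (by simp)))
  have hNx : NN f (A ++ [x]) := by
    intro l hl
    obtain ⟨l₁, l₂, rfl, k1, k2⟩ := List.sublist_append_iff.mp hl
    rcases List.sublist_cons_iff.mp k2 with k3 | ⟨l₃, rfl, k3⟩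
    · have : l₂ = [] := by simpa using k3
      subst this
      exact hN _ (by simpa using k1.trans (List.sublist_append_left _ _))
    · have : l₃ = [] := by simpa using k3
      subst this
      rw [hx, hs.alt.sub, hs.alt.smul]
      have := h1 (f (l₁ ++ [z.1]), f (l₁ ++ [S])) (List.mem_map.mpr ⟨l₁, by simpa using k1, rfl⟩)
      simpa using this
  have h2 := (hs.tn [x] (by simp [hxH]) hNx).nonneg (ρ := z.2) (x := x) (by simp) (by simp)
  have hd := hs.dual.1
  rw [List.pairwise_middle (fun h => ⟨h.2, h.1⟩), List.pairwise_cons] at hd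
  have h3 : z.2 S = 0 := by
    rw [hS, map_list_sum]
    apply List.sum_eq_zero
    intro t ht
    obtain ⟨w, hw, rfl⟩ := List.mem_map.mp ht
    obtain ⟨z', hz', rfl⟩ := List.mem_map.mp hw
    exact (hd.1 z' hz').1
  rw [hx, map_sub, h3, map_smul, hs.dual.2 z (by simp)] at h2
  simp at h2
  linarith

theorem eval_sum {f : List E → ℝ} (hf : IsAlt f) {Z₁ Z₂ : List (E × (E →ₗ[ℝ] ℝ))}
    {z : E × (E →ₗ[ℝ] ℝ)} (I : List E) (v : E) (hv : v = ((Z₁ ++ z :: Z₂).map fun z => z.2 v • z.1).sum)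
    (h0 : ∀ z' ∈ Z₁ ++ Z₂, f (I ++ [z'.1]) = 0) : f (I ++ [v]) = z.2 v * f (I ++ [z.1]) := by
  have h1 : f (I ++ [v]) = ((Z₁ ++ z :: Z₂).map fun z => z.2 v * f (I ++ [z.1])).sum := by
    have := congrArg (hf.toLin I []) hv
    rw [map_list_sum, List.map_map] at this
    rw [IsAlt.toLin_apply] at this
    rw [this]
    congr 1
    apply List.map_congr_left
    intro z _
    simp [IsAlt.toLin_apply]
  rw [h1, List.map_append, List.map_cons, List.sum_append, List.sum_cons]
  have e1 : (Z₁.map fun z => z.2 v * f (I ++ [z.1])).sum = 0 := by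
    apply List.sum_eq_zero
    intro t ht
    obtain ⟨w, hw, rfl⟩ := List.mem_map.mp ht
    simp [h0 w (by simp [hw])]
  have e2 : (Z₂.map fun z => z.2 v * f (I ++ [z.1])).sum = 0 := by
    apply List.sum_eq_zero
    intro t ht
    obtain ⟨w, hw, rfl⟩ := List.mem_map.mp ht
    simp [h0 w (by simp [hw])]
  rw [e1, e2]; ring

theorem pairs_ext (P P' : List (E × F)) (h1 : P.map Prod.fst = P'.map Prod.fst)
    (h2 : P.map Prod.snd = P'.map Prod.snd) : P = P' := by
  induction P generalizing P' with
  | nil => simpa using h1.symm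
  | cons p P ih =>
    cases P' with
    | nil => simp at h1
    | cons p' P' =>
      simp only [List.map_cons, List.cons.injEq] at h1 h2
      rw [ih P' h1.2 h2.2, Prod.ext h1.1 h2.1]

theorem list_split {α : Type*} (L : List α) (i : ℕ) (hi : i < L.length) :
    L = L.take i ++ L[i] :: L.drop (i + 1) := by
  rw [List.getElem_cons_drop, List.take_append_drop]

theorem same_support {τ} {f : List E → ℝ} {H : Submodule ℝ E} {Z : List (E × (E →ₗ[ℝ] ℝ))}
    {g : List F → ℝ} {K : Submodule ℝ F} {Z' : List (F × (F →ₗ[ℝ] ℝ))} {P : List (E × F)}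
    (hT : Typ τ f H (P.map Prod.fst) Z) (hT' : Typ τ g K (P.map Prod.snd) Z') {v : E} {v' : F}
    (hv : v = (Z.map fun z => z.2 v • z.1).sum) (hv' : v' = (Z'.map fun z => z.2 v' • z.1).sum)
    (hP : ∀ l : List (E × F), l.Sublist P → (0 < f (l.map Prod.fst ++ [v]) ↔ 0 < g (l.map Prod.snd ++ [v']))) :
    List.Forall₂ (fun z z' => 0 < z.2 v ↔ 0 < z'.2 v') Z Z' := by
  obtain ⟨P', Q, e1, e2, e3, e4, hR⟩ := hT.rel hT'
  obtain rfl := pairs_ext _ _ e1 e2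
  have l1 : Q.length = Z.length := by have := congrArg List.length e3; simpa using this
  have l2 : Q.length = Z'.length := by have := congrArg List.length e4; simpa using this
  rw [List.forall₂_iff_get]
  refine ⟨by omega, ?_⟩
  intro i hi hi'
  have hiQ : i < Q.length := by omega
  simp only [List.get_eq_getElem]
  have sZ := list_split Z i hi
  have sZ' := list_split Z' i hi'
  have sQ := list_split Q i hiQ
  rw [sZ] at hT
  obtain ⟨I, hI, hp, h0⟩ := hT.facet
  obtain ⟨J, hJ, rfl⟩ := List.sublist_map_iff.mp hI
  have q1 : (Q[i]).1 = (Z[i]).1 := by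
    have : (Q.map Prod.fst)[i]? = (ws Z)[i]? := by rw [e3]
    simpa [hiQ, hi] using this
  have q2 : (Q[i]).2 = (Z'[i]).1 := by
    have : (Q.map Prod.snd)[i]? = (ws Z')[i]? := by rw [e4]
    simpa [hiQ, hi'] using this
  have hRq : ∀ x ∈ Q, 0 ≤ g (J.map Prod.snd ++ [x.2]) ∧
      (0 < f (J.map Prod.fst ++ [x.1]) ↔ 0 < g (J.map Prod.snd ++ [x.2])) := by
    intro x hx
    have := hR (J ++ [x]) (hJ.append (by simpa using hx))
    simp only [List.map_append, List.map_cons, List.map_nil] at this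
    exact this.2
  have hp' : 0 < g (J.map Prod.snd ++ [(Z'[i]).1]) := by
    rw [← q2]
    rw [← q1] at hp
    exact (hRq _ (List.getElem_mem hiQ)).2.mp hp
  have h0' : ∀ z' ∈ Z'.take i ++ Z'.drop (i + 1), g (J.map Prod.snd ++ [z'.1]) = 0 := by
    intro z' hz'
    have m1 : z'.1 ∈ (Q.take i ++ Q.drop (i + 1)).map Prod.snd := by
      rw [List.map_append, List.map_take, List.map_drop, e4, ← List.map_take, ← List.map_drop, ← List.map_append]
      exact List.mem_map_of_mem hz'
    obtain ⟨x, hx, hxz⟩ := List.mem_map.mp m1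
    have m2 : x.1 ∈ ws (Z.take i ++ Z.drop (i + 1)) := by
      have : x.1 ∈ (Q.take i ++ Q.drop (i + 1)).map Prod.fst := List.mem_map_of_mem hx
      rw [List.map_append, List.map_take, List.map_drop, e3, ← List.map_take, ← List.map_drop, ← List.map_append] at this
      exact this
    obtain ⟨z, hz, hzx⟩ := List.mem_map.mp m2
    have hxQ : x ∈ Q := by
      rcases List.mem_append.mp hx with hx | hx
      · exact List.mem_of_mem_take hx
      · exact List.mem_of_mem_drop hx
    have k := hRq x hxQ
    rw [← hzx, h0 z hz, hxz] at k
    have k2 : ¬ (0 < g (J.map Prod.snd ++ [z'.1])) := fun h => lt_irrefl _ (k.2.mpr h)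
    exact le_antisymm (not_lt.mp k2) k.1
  have a1 := eval_sum hT.st.alt (J.map Prod.fst) v (by rw [← sZ]; exact hv) h0
  have a2 := eval_sum hT'.st.alt (J.map Prod.snd) v' (by rw [← sZ']; exact hv') h0'
  have a3 := hP J hJ
  rw [a1, a2, mul_pos_iff_of_pos_right hp, mul_pos_iff_of_pos_right hp'] at a3
  exact a3

theorem RedP.same {v : E} {Z s y l} (h : RedP v Z s y l) {v' : F} : ∀ {Z' s' y' l'},
    RedP v' Z' s' y' l' → List.Forall₂ (fun z z' => 0 < z.2 v ↔ 0 < z'.2 v') Z Z' → s = s' := by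
  have key : ∀ {Z : List (E × (E →ₗ[ℝ] ℝ))} {Z' : List (F × (F →ₗ[ℝ] ℝ))},
      List.Forall₂ (fun z z' => 0 < z.2 v ↔ 0 < z'.2 v') Z Z' →
      ((∃ z ∈ Z, 0 < z.2 v) ↔ ∃ z ∈ Z', 0 < z.2 v') := by
    intro Z Z' h
    induction h with
    | nil => simp
    | cons h _ ih => simp only [List.mem_cons, exists_eq_or_imp, h, ih]
  induction h with
  | start w β l hp h0 =>
    intro Z' s' y' l' h' hF
    cases h' with
    | start => rfl
    | skip z' l' _ _ _ h' h0' => cases hF with | cons h1 h2 => simp [hp, h0'] at h1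
    | add w' β' l' _ y' l'' h' hp' =>
      cases hF with
      | cons h1 h2 =>
        obtain ⟨z, hz, hz'⟩ := (key h2).mpr h'.pos
        simp [h0 z hz] at hz'
  | skip z l s y l' h h0 ih =>
    intro Z' s' y' l' h' hF
    cases h' with
    | start w' β' l' hp' h0' => cases hF with | cons h1 h2 => simp [hp', h0] at h1
    | skip z' l' _ _ _ h' h0' => cases hF with | cons h1 h2 => rw [ih h' h2]
    | add w' β' l' _ y' l'' h' hp' => cases hF with | cons h1 h2 => simp [hp', h0] at h1
  | add w β l s y l' h hp ih =>
    intro Z' s' y' l' h' hF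
    cases h' with
    | start w' β' l' hp' h0' =>
      cases hF with
      | cons h1 h2 =>
        obtain ⟨z, hz, hz'⟩ := (key h2).mp h.pos
        simp [h0' z hz] at hz'
    | skip z' l' _ _ _ h' h0' => cases hF with | cons h1 h2 => simp [hp, h0'] at h1
    | add w' β' l' _ y' l'' h' hp' => cases hF with | cons h1 h2 => rw [ih h' h2]

theorem not_redP {v' : F} {Z' s' y' l'} (h : RedP v' Z' s' y' l') {Z : List (E × (E →ₗ[ℝ] ℝ))}
    (hF : List.Forall₂ (fun z z' => 0 < z.2 (0:E) ↔ 0 < z'.2 v') Z Z') : False := by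
  obtain ⟨z, hz, hp⟩ := h.pos
  clear h
  induction hF with
  | nil => simp at hz
  | cons h1 _ ih =>
    rcases List.mem_cons.mp hz with rfl | hz
    · simp at h1; linarith
    · exact ih hz

theorem snoc_pair {P : List (E × F)} {A : List E} {e : E} {B : List F} {e' : F}
    (h1 : P.map Prod.fst = A ++ [e]) (h2 : P.map Prod.snd = B ++ [e']) :
    ∃ P₀, P = P₀ ++ [(e, e')] ∧ P₀.map Prod.fst = A ∧ P₀.map Prod.snd = B := by
  rcases List.eq_nil_or_concat P with rfl | ⟨P₀, p, rfl⟩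
  · simp at h1
  · simp only [List.concat_eq_append, List.map_append, List.map_cons, List.map_nil] at h1 h2
    obtain ⟨a1, a2⟩ := List.append_inj' h1 rfl
    obtain ⟨b1, b2⟩ := List.append_inj' h2 rfl
    refine ⟨P₀, ?_, a1, b1⟩
    have : p = (e, e') := Prod.ext (by simpa using a2) (by simpa using b2)
    rw [this]; simp

theorem Typ.same {τ} {f : List E → ℝ} {H : Submodule ℝ E} {A : List E} {Z : List (E × (E →ₗ[ℝ] ℝ))}
    (h : Typ τ f H A Z) : ∀ {τ'} {g : List F → ℝ} {K : Submodule ℝ F} {B : List F} {Z' : List (F × (F →ₗ[ℝ] ℝ))},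
    Typ τ' g K B Z' → ∀ P : List (E × F), P.map Prod.fst = A → P.map Prod.snd = B →
      (∀ l : List (E × F), l.Sublist P → (0 < f (l.map Prod.fst) ↔ 0 < g (l.map Prod.snd))) → τ = τ' := by
  have mism : ∀ {f : List E → ℝ} {H H₀ : Submodule ℝ E} {h : E →ₗ[ℝ] ℝ} {e : E} {P : List (E × F)} {Z}
      {g : List F → ℝ} {K : Submodule ℝ F} {Z'} {e' : F}, St (fun l => f (l ++ [e])) H₀ (P.map Prod.fst) Z →
      Co f H H₀ h e → St g K (P.map Prod.snd) Z' →
      (∀ l : List (E × F), l.Sublist (P ++ [(e, e')]) → (0 < f (l.map Prod.fst) ↔ 0 < g (l.map Prod.snd))) → False := by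
    intro f H H₀ h e P Z g K Z' e' h1 h2 h3 h4
    obtain ⟨l, hl, hp⟩ := h3.basis
    obtain ⟨l', hl', rfl⟩ := List.sublist_map_iff.mp hl
    have := (h4 l' (hl'.trans (by simp))).mpr hp
    rw [h2.van _ (fun x hx => h1.memA x ((hl'.map Prod.fst).subset hx))] at this
    exact lt_irrefl _ this
  have mism' : ∀ {f : List F → ℝ} {H H₀ : Submodule ℝ F} {h : F →ₗ[ℝ] ℝ} {e : F} {P : List (E × F)} {Z}
      {g : List E → ℝ} {K : Submodule ℝ E} {Z'} {e' : E}, St (fun l => f (l ++ [e])) H₀ (P.map Prod.snd) Z →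
      Co f H H₀ h e → St g K (P.map Prod.fst) Z' →
      (∀ l : List (E × F), l.Sublist (P ++ [(e', e)]) → (0 < g (l.map Prod.fst) ↔ 0 < f (l.map Prod.snd))) → False := by
    intro f H H₀ h e P Z g K Z' e' h1 h2 h3 h4
    obtain ⟨l, hl, hp⟩ := h3.basis
    obtain ⟨l', hl', rfl⟩ := List.sublist_map_iff.mp hl
    have := (h4 l' (hl'.trans (by simp))).mp hp
    rw [h2.van _ (fun x hx => h1.memA x ((hl'.map Prod.snd).subset hx))] at this
    exact lt_irrefl _ this
  have last : ∀ {f : List E → ℝ} {g : List F → ℝ} {P : List (E × F)} {e : E} {e' : F},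
      (∀ l : List (E × F), l.Sublist (P ++ [(e, e')]) → (0 < f (l.map Prod.fst) ↔ 0 < g (l.map Prod.snd))) →
      ∀ l : List (E × F), l.Sublist P → (0 < f (l.map Prod.fst ++ [e]) ↔ 0 < g (l.map Prod.snd ++ [e'])) := by
    intro f g P e e' h l hl
    simpa using h (l ++ [(e, e')]) (hl.append_right _)
  have front : ∀ {f : List E → ℝ} {g : List F → ℝ} {P : List (E × F)} {p : E × F},
      (∀ l : List (E × F), l.Sublist (P ++ [p]) → (0 < f (l.map Prod.fst) ↔ 0 < g (l.map Prod.snd))) →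
      ∀ l : List (E × F), l.Sublist P → (0 < f (l.map Prod.fst) ↔ 0 < g (l.map Prod.snd)) := by
    intro f g P p h l hl
    exact h l (hl.trans (by simp))
  induction h with
  | nil f H h1 h2 h3 =>
    intro τ' g K B Z' h' P e1 e2 hP
    have : P = [] := by simpa using e1
    subst this
    cases h' with
    | nil => rfl
    | coloop => simp at e2
    | loop => simp at e2
    | pos => simp at e2
  | coloop τ f H H₀ h e A Z hT hc ih =>
    intro τ' g K B Z' h' P e1 e2 hP
    cases h' with
    | nil => simp at e2; subst e2; simp at e1
    | coloop τ' _ _ K₀ k e' B Z' hT' hc' =>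
      obtain ⟨P, rfl, rfl, rfl⟩ := snoc_pair e1 e2
      rw [ih hT' P rfl rfl (last hP)]
    | loop τ' _ _ B Z' hT' =>
      obtain ⟨P, rfl, rfl, rfl⟩ := snoc_pair e1 e2
      exact (mism hT.st hc hT'.st hP).elim
    | pos τ' _ _ B Z' v' _ y' l' hT' hr' hv' hy' =>
      obtain ⟨P, rfl, rfl, rfl⟩ := snoc_pair e1 e2
      exact (mism hT.st hc hT'.st hP).elim
  | loop τ f H A Z hT ih =>
    intro τ' g K B Z' h' P e1 e2 hP
    cases h' with
    | nil => simp at e2; subst e2; simp at e1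
    | coloop τ' _ _ K₀ k e' B Z' hT' hc' =>
      obtain ⟨P, rfl, rfl, rfl⟩ := snoc_pair e1 e2
      exact (mism' hT'.st hc' hT.st hP).elim
    | loop τ' _ _ B Z' hT' =>
      obtain ⟨P, rfl, rfl, rfl⟩ := snoc_pair e1 e2
      rw [ih hT' P rfl rfl (front hP)]
    | pos τ' _ _ B Z' v' s' y' l' hT' hr' hv' hy' =>
      obtain ⟨P, rfl, rfl, rfl⟩ := snoc_pair e1 e2
      obtain rfl := ih hT' P rfl rfl (front hP)
      have hF := same_support hT hT' (v := 0) (v' := v') (by simp) (by rw [← hr'.sum, hy']) (last hP)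
      exact (not_redP hr' hF).elim
  | pos τ f H A Z v s y l hT hr hv hy ih =>
    intro τ' g K B Z' h' P e1 e2 hP
    cases h' with
    | nil => simp at e2; subst e2; simp at e1
    | coloop τ' _ _ K₀ k e' B Z' hT' hc' =>
      obtain ⟨P, rfl, rfl, rfl⟩ := snoc_pair e1 e2
      exact (mism' hT'.st hc' hT.st hP).elim
    | loop τ' _ _ B Z' hT' =>
      obtain ⟨P, rfl, rfl, rfl⟩ := snoc_pair e1 e2
      obtain rfl := ih hT' P rfl rfl (front hP)
      have hF := same_support hT hT' (v := v) (v' := 0) (by rw [← hr.sum, hy]) (by simp) (last hP)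
      refine (not_redP (Z := Z') hr ?_).elim
      rw [List.forall₂_iff_get] at hF ⊢
      exact ⟨hF.1.symm, fun i h₁ h₂ => (hF.2 i h₂ h₁).symm⟩
    | pos τ' _ _ B Z' v' s' y' l' hT' hr' hv' hy' =>
      obtain ⟨P, rfl, rfl, rfl⟩ := snoc_pair e1 e2
      obtain rfl := ih hT' P rfl rfl (front hP)
      have hF := same_support hT hT' (v := v) (v' := v') (by rw [← hr.sum, hy]) (by rw [← hr'.sum, hy']) (last hP)
      rw [hr.same hr' hF]

end Positroid


namespace Positroid

theorem RedP.realize {E : Type} [AddCommGroup E] [Module ℝ E] (Z : List (E × (E →ₗ[ℝ] ℝ))) :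
    ∀ (s : List Bool), s.length < Z.length → DualL Z →
    ∃ v ∈ Submodule.span ℝ {w | w ∈ ws Z}, ∀ u : E, (∀ z ∈ Z, z.2 u = 0) →
      ∃ y l, RedP (v + u) Z s y l ∧ y.1 = v := by
  induction Z with
  | nil => intro s hs; simp at hs
  | cons z Z ih =>
    intro s hs hd
    have hp := (List.pairwise_cons.mp hd.1).1
    have hz1 : z.2 z.1 = 1 := hd.2 z (by simp)
    have hker : ∀ v ∈ Submodule.span ℝ {w | w ∈ ws Z}, z.2 v = 0 := by
      intro v hv
      have : Submodule.span ℝ {w | w ∈ ws Z} ≤ LinearMap.ker z.2 := by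
        rw [Submodule.span_le]
        intro w hw
        obtain ⟨z', hz', rfl⟩ := List.mem_map.mp hw
        exact (hp z' hz').1
      exact this hv
    have hmono : Submodule.span ℝ {w | w ∈ ws Z} ≤ Submodule.span ℝ {w | w ∈ ws (z :: Z)} := by
      apply Submodule.span_mono
      intro w hw
      exact List.mem_cons_of_mem _ hw
    have hzs : z.1 ∈ Submodule.span ℝ {w | w ∈ ws (z :: Z)} := Submodule.subset_span (by simp)
    cases s with
    | nil =>
      refine ⟨z.1, hzs, fun u hu => ?_⟩
      have h1 : z.2 (z.1 + u) = 1 := by rw [map_add, hz1, hu z (by simp), add_zero]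
      refine ⟨_, _, RedP.start z.1 z.2 Z (by rw [h1]; exact one_pos) ?_, by simp [h1]⟩
      intro z' hz'
      rw [map_add, (hp z' hz').2, hu z' (by simp [hz']), add_zero]
    | cons b s =>
      obtain ⟨v, hv, hR⟩ := ih s (by simpa using hs) hd.tail
      cases b with
      | false =>
        refine ⟨v, hmono hv, fun u hu => ?_⟩
        obtain ⟨y, l, hr, hy⟩ := hR u (fun z' hz' => hu z' (by simp [hz']))
        exact ⟨y, l, .skip z Z s y l hr (by rw [map_add, hker v hv, hu z (by simp), add_zero]), hy⟩
      | true =>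
        refine ⟨z.1 + v, Submodule.add_mem _ hzs (hmono hv), fun u hu => ?_⟩
        obtain ⟨y, l, hr, hy⟩ := hR (z.1 + u) (fun z' hz' => by
          rw [map_add, (hp z' hz').2, hu z' (by simp [hz']), add_zero])
        have e : v + (z.1 + u) = z.1 + v + u := by abel
        rw [e] at hr
        have h1 : z.2 (z.1 + v + u) = 1 := by
          rw [map_add, map_add, hker v hv, hz1, hu z (by simp)]; norm_num
        refine ⟨_, _, .add z.1 z.2 Z s y l hr (by rw [h1]; exact one_pos), ?_⟩
        simp [h1, hy]

/-- length of the list of dual pairs -/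
def cu : List (Option (Option (List Bool))) → ℕ
  | [] => 0
  | none :: τ => cu τ + 1
  | some none :: τ => cu τ
  | some (some s) :: τ => s.count true + (cu τ - s.length)

/-- valid types -/
def Valid : List (Option (Option (List Bool))) → Prop
  | [] => True
  | none :: τ => Valid τ
  | some none :: τ => Valid τ
  | some (some s) :: τ => Valid τ ∧ s.length < cu τ

theorem Typ.valid {E : Type} [AddCommGroup E] [Module ℝ E] {τ} {f : List E → ℝ} {H : Submodule ℝ E}
    {A : List E} {Z : List (E × (E →ₗ[ℝ] ℝ))} (h : Typ τ f H A Z) :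
    Valid τ ∧ cu τ = Z.length ∧ τ.length = A.length := by
  induction h with
  | nil f H h1 h2 h3 => simp [Valid, cu]
  | coloop τ f H H₀ h e A Z hT hc ih => simpa [Valid, cu] using ih
  | loop τ f H A Z hT ih => simpa [Valid, cu] using ih
  | pos τ f H A Z v s y l hT hr hv hy ih =>
    have := hr.length
    simp [Valid, cu]
    refine ⟨⟨ih.1, ?_⟩, ?_, ih.2.2⟩ <;> omega

/-- coordinate functionals with signs -/
noncomputable def Phi : ℕ → List ((ℕ → ℝ) →ₗ[ℝ] ℝ)
  | 0 => []
  | k + 1 => LinearMap.proj k :: (Phi k).map (fun β => -β)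

theorem Phi_length (k : ℕ) : (Phi k).length = k := by
  induction k with
  | zero => rfl
  | succ k ih => simp [Phi, ih]

theorem Phi_zero (k j : ℕ) (h : k ≤ j) : ∀ b ∈ Phi k, b (Pi.single j 1) = 0 := by
  induction k with
  | zero => simp [Phi]
  | succ k ih =>
    intro b hb
    simp only [Phi, List.mem_cons, List.mem_map] at hb
    rcases hb with rfl | ⟨b', hb', rfl⟩
    · simp [Pi.single_apply]; omega
    · simp [ih (by omega) b' hb']

def Hk (k : ℕ) : Submodule ℝ (ℕ → ℝ) where
  carrier := {x | ∀ i, k ≤ i → x i = 0}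
  add_mem' := by intro a b ha hb i hi; simp [ha i hi, hb i hi]
  zero_mem' := by intro i _; rfl
  smul_mem' := by intro c a ha i hi; simp [ha i hi]

theorem G_Phi_succ (k : ℕ) : (fun l => G (Phi (k + 1)) (l ++ [Pi.single k 1])) = G (Phi k) := by
  ext l
  have h1 := (G_isAlt (Phi (k + 1))).move' [] (l.map (fun y => -y)) (Pi.single k 1)
  simp only [List.map_map, Function.comp_def, neg_neg, List.nil_append, List.map_id'] at h1
  rw [h1, Phi, G_col]
  · rw [G_neg]
    simp [Function.comp_def]
  · intro b hb
    obtain ⟨b', hb', rfl⟩ := List.mem_map.mp hb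
    simp [Phi_zero k k le_rfl b' hb']

theorem Co_Phi (k : ℕ) : Co (G (Phi (k + 1))) (Hk (k + 1)) (Hk k) (LinearMap.proj k) (Pi.single k 1) where
  alt := G_isAlt _
  van := by
    intro l hl
    have h0 : ∀ x ∈ l, (LinearMap.proj k : (ℕ → ℝ) →ₗ[ℝ] ℝ) x = 0 := fun x hx => hl x hx k le_rfl
    cases l with
    | nil => simp [G, Phi]
    | cons x l =>
      rw [Phi, G_row _ _ _ _ (fun y hy => h0 y (by simp [hy])), h0 x (by simp), zero_mul]
  he := by simp
  h0 := fun x hx => hx k le_rfl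
  le := fun x hx i hi => hx i (by omega)
  eH := by
    intro i hi
    simp [Pi.single_apply]; omega
  q := by
    intro x hx i hi
    rw [qmap_apply]
    simp only [LinearMap.proj_apply, Pi.sub_apply, Pi.smul_apply, Pi.single_apply]
    split_ifs with h
    · subst h; simp
    · rw [hx i (by omega)]; simp

theorem exists_real (τ : List (Option (Option (List Bool)))) (h : Valid τ) :
    ∃ k A Z, Typ τ (G (Phi k)) (Hk k) A Z := by
  induction τ with
  | nil =>
    refine ⟨0, [], [], .nil _ _ (G_isAlt _) ?_ ?_⟩
    · simp [Phi, G_nil]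
    · intro x hx; ext i; exact hx i (Nat.zero_le _)
  | cons t τ ih =>
    match t with
    | none =>
      obtain ⟨k, A, Z, hT⟩ := ih (by simpa [Valid] using h)
      rw [← G_Phi_succ] at hT
      exact ⟨k + 1, _, _, .coloop _ _ _ _ _ _ _ _ hT (Co_Phi k)⟩
    | some none =>
      obtain ⟨k, A, Z, hT⟩ := ih (by simpa [Valid] using h)
      exact ⟨k, _, _, .loop _ _ _ _ _ hT⟩
    | some (some s) =>
      simp only [Valid] at h
      obtain ⟨k, A, Z, hT⟩ := ih h.1
      obtain ⟨v, hv, hR⟩ := RedP.realize Z s (by rw [← hT.valid.2.1]; exact h.2) hT.st.dual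
      obtain ⟨y, l, hr, hy⟩ := hR 0 (by simp)
      rw [add_zero] at hr
      refine ⟨k, _, _, .pos _ _ _ _ _ v s y l hT hr ?_ hy⟩
      have : Submodule.span ℝ {w | w ∈ ws Z} ≤ Hk k := by
        rw [Submodule.span_le]
        intro w hw
        obtain ⟨z', hz', rfl⟩ := List.mem_map.mp hw
        exact hT.st.memW z' hz'
      exact this hv

/-! counting -/

/-- boolean lists of length less than `u` -/
def shapes : ℕ → Finset (List Bool)
  | 0 => ∅
  | u + 1 => insert [] (((shapes u).image (List.cons true)) ∪ (shapes u).image (List.cons false))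

theorem mem_shapes (u : ℕ) : ∀ s, s ∈ shapes u ↔ s.length < u := by
  induction u with
  | zero => intro s; simp [shapes]
  | succ u ih =>
    intro s
    cases s with
    | nil => simp [shapes]
    | cons b s => cases b <;> simp [shapes, ih]

theorem sum_shapes (u : ℕ) (t : ℝ) : ∑ s ∈ shapes u, t ^ (s.count true + (u - s.length))
    = t * ((1 + t) ^ u - t ^ u) := by
  induction u with
  | zero => simp [shapes]
  | succ u ih =>
    rw [shapes, sum_insert, sum_union, sum_image, sum_image]
    · simp only [List.count_cons_self, List.length_cons, List.count_nil, List.length_nil]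
      have e1 : ∀ s : List Bool, t ^ (List.count true s + 1 + (u + 1 - (s.length + 1))) = t * t ^ (s.count true + (u - s.length)) := by
        intro s
        rw [← pow_succ']; congr 1; omega
      have e2 : ∀ s : List Bool, t ^ (List.count true (false :: s) + (u + 1 - (s.length + 1))) = t ^ (s.count true + (u - s.length)) := by
        intro s
        congr 1; simp
      simp only [e1, e2, ← mul_sum, ih]
      simp only [Nat.sub_zero, zero_add]
      ring
    · intro a _ b _ h; simpa using h
    · intro a _ b _ h; simpa using h
    · rw [Finset.disjoint_left]; intro a; simp; intro x _ hx y _ hy; rw [← hx] at hy; simp at hy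
    · simp

/-- all possible steps -/
def steps (u : ℕ) : Finset (Option (Option (List Bool))) :=
  insert none (insert (some none) ((shapes u).image (fun s => some (some s))))

/-- the types of length `n` -/
def T : ℕ → Finset (List (Option (Option (List Bool))))
  | 0 => {[]}
  | n + 1 => (T n).biUnion (fun τ => (steps (cu τ)).image (fun x => x :: τ))

theorem mem_T (n : ℕ) : ∀ τ, τ ∈ T n ↔ Valid τ ∧ τ.length = n := by
  induction n with
  | zero =>
    intro τ
    simp only [T, mem_singleton, List.length_eq_zero_iff]
    constructor
    · rintro rfl; simp [Valid]
    · exact fun h => h.2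
  | succ n ih =>
    intro τ
    cases τ with
    | nil => simp [T]
    | cons x τ =>
      have : x :: τ ∈ T (n + 1) ↔ x ∈ steps (cu τ) ∧ τ ∈ T n := by
        simp only [T, mem_biUnion, mem_image, List.cons.injEq]
        constructor
        · rintro ⟨τ', h1, x', h2, rfl, rfl⟩; exact ⟨h2, h1⟩
        · rintro ⟨h1, h2⟩; exact ⟨τ, h2, x, h1, rfl, rfl⟩
      rw [this, ih]
      rcases x with _ | _ | s
      · simp [steps, Valid]
      · simp [steps, Valid]
      · simp [steps, Valid, mem_shapes]; tauto

/-- generating sum -/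
noncomputable def SS (n : ℕ) (t : ℝ) : ℝ := ∑ τ ∈ T n, t ^ cu τ

theorem SS_zero (t : ℝ) : SS 0 t = 1 := by simp [SS, T, cu]

theorem SS_succ (n : ℕ) (t : ℝ) : SS (n + 1) t = SS n t + t * SS n (t + 1) := by
  unfold SS
  rw [T, sum_biUnion, mul_sum, ← sum_add_distrib]
  · refine sum_congr rfl fun τ _ => ?_
    rw [sum_image (by intro a _ b _ h; simpa using h), steps, sum_insert (by simp), sum_insert (by simp),
      sum_image (by intro a _ b _ h; simpa using h)]
    simp only [cu]
    rw [sum_shapes]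
    ring
  · intro a _ b _ hab
    rw [Function.onFun, Finset.disjoint_left]
    intro l h1 h2
    simp only [mem_image] at h1 h2
    obtain ⟨x, _, rfl⟩ := h1
    obtain ⟨x', _, h⟩ := h2
    simp at h
    exact hab h.2.symm

open MeasureTheory in
theorem integral_eq (n : ℕ) : ∀ t : ℕ,
    IntegrableOn (fun x : ℝ => (1 + x) ^ n * x ^ t * Real.exp (-x)) (Set.Ioi 0) ∧
    ∫ x in Set.Ioi (0 : ℝ), (1 + x) ^ n * x ^ t * Real.exp (-x) = (t.factorial : ℝ) * SS n (t + 1) := by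
  induction n with
  | zero =>
    intro t
    have h1 := Real.GammaIntegral_convergent (s := (t : ℝ) + 1) (by positivity)
    have h2 := Real.Gamma_eq_integral (s := (t : ℝ) + 1) (by positivity)
    rw [Real.Gamma_nat_eq_factorial] at h2
    have e : ∀ x : ℝ, Real.exp (-x) * x ^ ((t : ℝ) + 1 - 1) = (1 + x) ^ 0 * x ^ t * Real.exp (-x) := by
      intro x
      rw [add_sub_cancel_right, Real.rpow_natCast]; ring
    simp only [e] at h1 h2
    exact ⟨h1, by rw [← h2, SS_zero, mul_one]⟩
  | succ n ih =>
    intro t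
    obtain ⟨i1, v1⟩ := ih t
    obtain ⟨i2, v2⟩ := ih (t + 1)
    have e : (fun x : ℝ => (1 + x) ^ (n + 1) * x ^ t * Real.exp (-x)) =
      fun x => (1 + x) ^ n * x ^ t * Real.exp (-x) + (1 + x) ^ n * x ^ (t + 1) * Real.exp (-x) := by
      ext x; ring
    rw [e]
    refine ⟨i1.add i2, ?_⟩
    rw [integral_add i1 i2, v1, v2, SS_succ, Nat.factorial_succ]
    push_cast
    ring

end Positroid


namespace Positroid

theorem sort_sublist {n : ℕ} (B : Finset (Fin n)) : B.sort.Sublist (List.finRange n) := by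
  refine List.sublist_of_subperm_of_sortedLE ?_ B.sortedLT_sort.sortedLE ?_
  · exact (List.subperm_of_subset (sort_nodup _ _) (fun x _ => List.mem_finRange x))
  · rw [← Fin.sort_univ]; exact (sortedLT_sort _).sortedLE

theorem eq_sort {n : ℕ} {l : List (Fin n)} (h : l.Sublist (List.finRange n)) :
    l = l.toFinset.sort := by
  have h1 : l.Nodup := (List.nodup_finRange n).sublist h
  have h2 : l.Pairwise (· ≤ ·) := by
    have : (List.finRange n).Pairwise (· ≤ ·) := by
      rw [← Fin.sort_univ]; exact pairwise_sort _ _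
    exact this.sublist h
  exact ((List.toFinset_sort (r := (· ≤ ·)) h1).mpr h2).symm

variable {E : Type} [AddCommGroup E] [Module ℝ E]

/-- the matrix of functionals against vectors -/
noncomputable def mat (d : ℕ) {n : ℕ} (R : List (E →ₗ[ℝ] ℝ)) (a : Fin n → E) : Matrix (Fin d) (Fin n) ℝ :=
  Matrix.of fun i j => R.getD i 0 (a j)

theorem G_sort {d n : ℕ} {R : List (E →ₗ[ℝ] ℝ)} (hR : R.length = d) (a : Fin n → E)
    {B : Finset (Fin n)} (h : B.card = d) :
    G R (B.sort.map a) = ((mat d R a).submatrix id (B.orderEmbOfFin h)).det := by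
  rw [G_eq (n := d) hR (by simp [h])]
  congr 1
  ext i j
  have hj : (j : ℕ) < B.sort.length := by simp [h]
  simp [mat, orderEmbOfFin_apply, List.getD_eq_getElem?_getD, List.getElem?_eq_getElem hj]

theorem G_basis {d n : ℕ} {R : List (E →ₗ[ℝ] ℝ)} (hR : R.length = d) (a : Fin n → E)
    (B : Finset (Fin n)) :
    (B.card = d ∧ LinearIndependent ℝ (fun j : B => fun i => mat d R a i j.1)) ↔
      G R (B.sort.map a) ≠ 0 := by
  by_cases h : B.card = d
  · rw [G_sort hR a h]
    simp only [h, true_and]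
    rw [← isUnit_iff_ne_zero, ← Matrix.isUnit_iff_isUnit_det, ← Matrix.linearIndependent_cols_iff_isUnit]
    rw [← linearIndependent_equiv (B.orderIsoOfFin h).toEquiv]
    exact Iff.rfl
  · simp only [h, false_and, false_iff, not_not]
    by_contra h'
    apply h
    have := G_length h'
    simp at this
    omega

theorem minors_iff {d n : ℕ} {R : List (E →ₗ[ℝ] ℝ)} (hR : R.length = d) (a : Fin n → E) :
    (∀ f : Fin d → Fin n, StrictMono f → 0 ≤ ((mat d R a).submatrix id f).det) ↔
      NN (G R) ((List.finRange n).map a) := by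
  constructor
  · intro h l hl
    obtain ⟨l', hl', rfl⟩ := List.sublist_map_iff.mp hl
    rw [eq_sort hl']
    by_cases hc : l'.toFinset.card = d
    · rw [G_sort hR a hc]
      exact h _ (OrderEmbedding.strictMono _)
    · by_contra h'
      have := G_length (ne_of_not_le h').symm
      simp only [List.length_map, length_sort] at this
      omega
  · intro h f hf
    have hc : (univ.map ⟨f, hf.injective⟩).card = d := by simp
    have := h _ ((sort_sublist (univ.map ⟨f, hf.injective⟩)).map a)
    rw [G_sort hR a hc] at this
    rwa [← orderEmbOfFin_unique hc (f := f) (by simp) hf] at this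

theorem exists_basis {d n : ℕ} (M : Matrix (Fin d) (Fin n) ℝ) (h : M.rank = d) :
    ∃ B : Finset (Fin n), B.card = d ∧ LinearIndependent ℝ (fun j : B => fun i => M i j.1) := by
  obtain ⟨f, hf, -, hl⟩ := Submodule.exists_fun_fin_finrank_span_eq ℝ (Set.range M.col)
  have hd : Module.finrank ℝ (Submodule.span ℝ (Set.range M.col)) = d := by
    rw [← Matrix.rank_eq_finrank_span_cols, h]
  generalize Module.finrank ℝ (Submodule.span ℝ (Set.range M.col)) = e at f hf hl hd
  subst hd
  choose g hg using hf
  have hgf : M.col ∘ g = f := funext hg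
  have hgi : Function.Injective g := by
    intro x y hxy
    apply hl.injective
    rw [← hg, ← hg, hxy]
  refine ⟨univ.map ⟨g, hgi⟩, by simp, ?_⟩
  have : LinearIndependent ℝ (fun j : Set.range g => M.col j) := by
    rw [← linearIndependent_equiv (Equiv.ofInjective g hgi)]
    subst hgf
    exact hl
  refine (linearIndependent_equiv' (Equiv.subtypeEquivRight (by simp)) ?_).mp this
  rfl

theorem rank_of_basis {d n : ℕ} (M : Matrix (Fin d) (Fin n) ℝ) (B : Finset (Fin n)) (hc : B.card = d)
    (h : LinearIndependent ℝ (fun j : B => fun i => M i j.1)) : M.rank = d := by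
  refine le_antisymm ((M.rank_le_card_height).trans (by simp)) ?_
  have := M.rank_submatrix_le id (B.orderIsoOfFin hc · |>.1)
  refine le_trans ?_ this
  rw [← linearIndependent_equiv (B.orderIsoOfFin hc).toEquiv] at h
  have h2 := LinearIndependent.rank_matrix (M := (M.submatrix id (B.orderIsoOfFin hc · |>.1)).transpose) h
  rw [Matrix.rank_transpose] at h2
  rw [h2, Fintype.card_fin]

/-- the bases cut out by `f` -/
def HasBas {n : ℕ} (f : List E → ℝ) (a : Fin n → E) (S : Finset (Finset (Fin n))) : Prop :=
  ∀ B : Finset (Fin n), B ∈ S ↔ 0 < f (B.sort.map a)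

/-- the combinatorial type of a collection of bases -/
def HasType {n : ℕ} (S : Finset (Finset (Fin n))) (τ : List (Option (Option (List Bool)))) : Prop :=
  ∃ (k : ℕ) (a : Fin n → (ℕ → ℝ)) (Z : _), Typ τ (G (Phi k)) (Hk k) ((List.finRange n).map a) Z ∧
    HasBas (G (Phi k)) a S

theorem NN.pos_iff {n : ℕ} {f : List E → ℝ} {a : Fin n → E} (h : NN f ((List.finRange n).map a))
    (B : Finset (Fin n)) : f (B.sort.map a) ≠ 0 ↔ 0 < f (B.sort.map a) :=
  ⟨fun h' => lt_of_le_of_ne (h _ ((sort_sublist B).map a)) h'.symm, fun h' => h'.ne'⟩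

theorem pair_map {F : Type} {n : ℕ} (a : Fin n → E) (b : Fin n → F) (B : List (Fin n)) :
    (B.map fun j => (a j, b j)).map Prod.fst = B.map a ∧ (B.map fun j => (a j, b j)).map Prod.snd = B.map b := by
  simp [Function.comp_def]

variable {F : Type} [AddCommGroup F] [Module ℝ F]

theorem bas_eq {n : ℕ} {τ f H Z} {g : List F → ℝ} {K Z'} {a : Fin n → E} {b : Fin n → F} {S S'}
    (h1 : Typ τ f H ((List.finRange n).map a) Z) (h2 : Typ τ g K ((List.finRange n).map b) Z')
    (hS : HasBas f a S) (hS' : HasBas g b S') : S = S' := by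
  obtain ⟨P, Q, e1, e2, -, -, hR⟩ := h1.rel h2
  have hP : P = (List.finRange n).map fun j => (a j, b j) := by
    apply pairs_ext
    · rw [e1, (pair_map _ _ _).1]
    · rw [e2, (pair_map _ _ _).2]
  ext B
  rw [hS, hS']
  have := (hR (B.sort.map fun j => (a j, b j)) (by
    rw [hP]; exact ((sort_sublist B).map _).trans (List.sublist_append_left _ _))).2.2
  rwa [(pair_map _ _ _).1, (pair_map _ _ _).2] at this

theorem typ_eq {n : ℕ} {τ τ' f H Z} {g : List F → ℝ} {K Z'} {a : Fin n → E} {b : Fin n → F} {S}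
    (h1 : Typ τ f H ((List.finRange n).map a) Z) (h2 : Typ τ' g K ((List.finRange n).map b) Z')
    (hS : HasBas f a S) (hS' : HasBas g b S) : τ = τ' := by
  refine h1.same h2 ((List.finRange n).map fun j => (a j, b j)) (pair_map _ _ _).1 (pair_map _ _ _).2 ?_
  intro l hl
  obtain ⟨l', hl', rfl⟩ := List.sublist_map_iff.mp hl
  rw [(pair_map _ _ _).1, (pair_map _ _ _).2, eq_sort hl', ← hS, ← hS']

theorem exists_type {n : ℕ} {S : Finset (Finset (Fin n))} (h : IsPositroid (fun B => B ∈ S)) :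
    ∃ τ ∈ T n, HasType S τ := by
  obtain ⟨d, M, ⟨hr, hm⟩, hB⟩ := h
  set R : List ((Fin d → ℝ) →ₗ[ℝ] ℝ) := (List.finRange d).map (fun i => LinearMap.proj i) with hRdef
  have hR : R.length = d := by simp [R]
  set a : Fin n → (Fin d → ℝ) := fun j i => M i j with ha
  have hget : ∀ i : Fin d, R.getD i 0 = LinearMap.proj i := by
    intro i
    simp [R, List.getD_eq_getElem?_getD]
  have hM : mat d R a = M := by
    ext i j
    simp only [mat, Matrix.of_apply, hget, a, LinearMap.proj_apply]
  have hNN : NN (G R) ((List.finRange n).map a) := by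
    rw [← minors_iff hR, hM]; exact hm
  have hS : HasBas (G R) a S := by
    intro B
    rw [← hNN.pos_iff, ← G_basis hR, hM]
    exact hB B
  obtain ⟨B, hBc, hBl⟩ := exists_basis M hr
  have hBG : G R (B.sort.map a) ≠ 0 := by
    rw [← G_basis hR, hM]; exact ⟨hBc, hBl⟩
  obtain ⟨τ, Z, hT⟩ := exists_typ ((List.finRange n).map a) (G R) ⊤ (G_isAlt R) hNN (by simp)
    ⟨_, (sort_sublist B).map a, hBG⟩ (by
      intro l _ hl x _
      obtain ⟨y, hy, hxy⟩ := G_solve hl x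
      have : x = y := by
        ext i
        exact hxy (LinearMap.proj i) (List.mem_map.mpr ⟨i, List.mem_finRange i, rfl⟩)
      rw [this]; exact hy)
  have hv := hT.valid
  have hlen : τ.length = n := by simpa using hv.2.2
  refine ⟨τ, (mem_T n τ).mpr ⟨hv.1, hlen⟩, ?_⟩
  obtain ⟨k, A, Z', hT'⟩ := exists_real τ hv.1
  have hA : A.length = n := by rw [← hT'.valid.2.2, hlen]
  subst hA
  have hAe : (List.finRange A.length).map A.get = A := List.map_get_finRange A
  refine ⟨k, A.get, Z', by rwa [hAe], ?_⟩
  have h2 : HasBas (G (Phi k)) A.get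
      (by classical exact univ.filter fun B => 0 < G (Phi k) (B.sort.map A.get)) := by
    intro B; simp
  rw [← hAe] at hT'
  rwa [bas_eq hT hT' hS h2]

theorem exists_positroid {n : ℕ} {τ} (h : τ ∈ T n) :
    ∃ S : Finset (Finset (Fin n)), IsPositroid (fun B => B ∈ S) ∧ HasType S τ := by
  rw [mem_T] at h
  obtain ⟨k, A, Z, hT⟩ := exists_real τ h.1
  have hA : A.length = n := by rw [← hT.valid.2.2, h.2]
  subst hA
  have hAe : (List.finRange A.length).map A.get = A := List.map_get_finRange A
  rw [← hAe] at hT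
  classical
  have hS : HasBas (G (Phi k)) A.get (univ.filter fun B => 0 < G (Phi k) (B.sort.map A.get)) := by
    intro B; simp
  have hNN : NN (G (Phi k)) ((List.finRange A.length).map A.get) :=
    hT.nnW.mono (List.sublist_append_left _ _)
  refine ⟨_, ⟨k, mat k (Phi k) A.get, ⟨?_, ?_⟩, ?_⟩, k, A.get, Z, hT, hS⟩
  · obtain ⟨l, hl, hpos⟩ := hT.st.basis
    obtain ⟨l', hl', rfl⟩ := List.sublist_map_iff.mp hl
    rw [eq_sort hl'] at hpos
    have := (G_basis (Phi_length k) A.get _).mpr hpos.ne'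
    exact rank_of_basis _ _ this.1 this.2
  · exact (minors_iff (Phi_length k) A.get).mpr hNN
  · intro B
    rw [G_basis (Phi_length k), hNN.pos_iff]
    exact hS B

theorem numPositroids_eq (n : ℕ) : numPositroids n = (T n).card := by
  unfold numPositroids
  choose φ hφ hφ' using fun S : {ℬ : Finset (Finset (Fin n)) // IsPositroid (fun B => B ∈ ℬ)} =>
    exists_type S.2
  have hb : Function.Bijective (fun S => (⟨φ S, hφ S⟩ : T n)) := by
    constructor
    · intro S S' h
      have h' : φ S = φ S' := congrArg Subtype.val h
      obtain ⟨k, a, Z, h1, h2⟩ := hφ' S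
      obtain ⟨k', a', Z', h1', h2'⟩ := hφ' S'
      rw [← h'] at h1'
      exact Subtype.ext (bas_eq h1 h1' h2 h2')
    · rintro ⟨τ, hτ⟩
      obtain ⟨S, hS, k, a, Z, h1, h2⟩ := exists_positroid hτ
      refine ⟨⟨S, hS⟩, Subtype.ext ?_⟩
      obtain ⟨k', a', Z', h1', h2'⟩ := hφ' ⟨S, hS⟩
      exact typ_eq h1' h1 h2' h2
  rw [Nat.card_congr (Equiv.ofBijective _ hb), Nat.card_eq_fintype_card, Fintype.card_coe]

end Positroid

open MeasureTheory in
/-- Let `X` be an exponential random variable with rate `1`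
(law with density `e^{-x}` on `[0, ∞)`) and `Y = 1 + X`.  Then for every
`n ≥ 1` the `n`-th moment of `Y` equals the number of positroids on `[n]`:
`E[Y^n] = ∫_0^∞ (1+x)^n e^{-x} dx = p(n)`. -/
theorem moments_are_numbers_of_positroids (n : ℕ) (hn : 1 ≤ n) :
    ∫ x in Set.Ioi (0 : ℝ), (1 + x) ^ n * Real.exp (-x) = (numPositroids n : ℝ) := by
  have h := (Positroid.integral_eq n 0).2
  simp only [pow_zero, mul_one, Nat.factorial_zero, Nat.cast_one, one_mul] at h
  rw [h, Positroid.numPositroids_eq]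
  simp [Positroid.SS]
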